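/- arXiv:math/0002178 — 2 statements merged into one kernel-verified Lean document; each statement's English description precedes it below -/
import Mathlib

section
/- For every cone σ in a fan Δ carrying a minimal extension sheaf E•, and for every subfan Λ of Δ, the A•-modules E•_σ and E•_Λ = E•(Λ) are finitely generated over A•. -/
open Module Function

set_option synthInstance.maxHeartbeats 1000000
set_option maxHeartbeats 1000000
set_option maxSynthPendingDepth 3

noncomputable section

/-! ## Cones and fans -/

/-- The convex cone generated by a finite set of vectors. -/
def coneGen {V : Type} [AddCommGroup V] [Module ℝ V] (s : Finset V) : Set V :=
  { x | ∃ c : V → ℝ, (∀ v ∈ s, 0 ≤ c v) ∧ x = ∑ v ∈ s, c v • v }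

/-- A (strictly convex, i.e. pointed) polyhedral cone in a real vector space. -/
structure Cone (V : Type) [AddCommGroup V] [Module ℝ V] where
  carrier : Set V
  isPoly : ∃ s : Finset V, carrier = coneGen s
  pointed : ∀ x ∈ carrier, -x ∈ carrier → x = 0

namespace Cone

variable {V : Type} [AddCommGroup V] [Module ℝ V]

/-- The linear span `V_σ` of a cone. -/
def spanC (σ : Cone V) : Submodule ℝ V := Submodule.span ℝ σ.carrier

/-- The dimension of a cone. -/
def dim (σ : Cone V) : ℕ := Module.finrank ℝ σ.spanC

/-- `τ` is a face of `σ` (cut out by a supporting linear form); `σ` is a face of itself. -/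
def IsFaceOf (τ σ : Cone V) : Prop :=
  ∃ f : V →ₗ[ℝ] ℝ, (∀ x ∈ σ.carrier, 0 ≤ f x) ∧
    τ.carrier = σ.carrier ∩ {x | f x = 0}

def IsProperFaceOf (τ σ : Cone V) : Prop := τ.IsFaceOf σ ∧ τ ≠ σ

/-- A cone is simplicial if it is generated by linearly independent vectors. -/
def IsSimplicial (σ : Cone V) : Prop :=
  ∃ s : Finset V, (LinearIndependent ℝ (fun v : s => (v : V))) ∧ σ.carrier = coneGen s

end Cone

/-- The zero cone `o`. -/
def zeroCone (V : Type) [AddCommGroup V] [Module ℝ V] : Cone V where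
  carrier := {0}
  isPoly := ⟨∅, by ext x; simp [coneGen]⟩
  pointed := by intro x hx _; simpa using hx

/-- A fan in `V`: a finite collection of pointed polyhedral cones, closed under taking
faces, such that the intersection of any two cones is a common face of both. -/
structure Fan (V : Type) [AddCommGroup V] [Module ℝ V] where
  cones : Set (Cone V)
  finite : cones.Finite
  zero_mem : zeroCone V ∈ cones
  face_mem : ∀ σ ∈ cones, ∀ τ : Cone V, τ.IsFaceOf σ → τ ∈ cones
  inter_mem : ∀ σ ∈ cones, ∀ σ' ∈ cones, ∃ τ ∈ cones,
    τ.IsFaceOf σ ∧ τ.IsFaceOf σ' ∧ τ.carrier = σ.carrier ∩ σ'.carrier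

namespace Fan

variable {V : Type} [AddCommGroup V] [Module ℝ V]

/-- A subfan of `Δ`: a subset of the cones closed under taking faces.  The subfans are
exactly the open subsets of the fan topology. -/
def IsSubfan (Δ : Fan V) (Λ : Set (Cone V)) : Prop :=
  Λ ⊆ Δ.cones ∧ ∀ σ ∈ Λ, ∀ τ : Cone V, τ.IsFaceOf σ → τ ∈ Λ

/-- The support `|Δ|` of a fan. -/
def support (Δ : Fan V) : Set V := ⋃ σ ∈ Δ.cones, σ.carrier

/-- A fan is complete if its support is the whole space. -/
def IsComplete (Δ : Fan V) : Prop := Δ.support = Set.univ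

/-- A fan is simplicial if all its cones are. -/
def IsSimplicial (Δ : Fan V) : Prop := ∀ σ ∈ Δ.cones, σ.IsSimplicial

/-- A fan is purely `n`-dimensional if every cone is a face of an `n`-dimensional cone. -/
def IsPurely (Δ : Fan V) (n : ℕ) : Prop :=
  ∀ σ ∈ Δ.cones, ∃ σ' ∈ Δ.cones, σ.IsFaceOf σ' ∧ σ'.dim = n

/-- The boundary subfan `∂Δ`: the cones supported in the topological boundary of `|Δ|`. -/
def boundary [TopologicalSpace V] (Δ : Fan V) : Set (Cone V) :=
  {τ ∈ Δ.cones | τ.carrier ⊆ frontier Δ.support}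

end Fan

/-! ## The graded algebra `A•` of polynomial functions (linear forms in degree 2) -/

/-- The algebra of polynomial functions on `V`, i.e. the subalgebra of `V → ℝ`
generated by the linear forms. -/
def polyAlg (V : Type) [AddCommGroup V] [Module ℝ V] : Subalgebra ℝ (V → ℝ) :=
  Algebra.adjoin ℝ {f : V → ℝ | IsLinearMap ℝ f}

/-- `A• = S•(V*)` as a commutative ring. -/
abbrev PolyRing (V : Type) [AddCommGroup V] [Module ℝ V] : Type := polyAlg V

variable (V : Type) [AddCommGroup V] [Module ℝ V]

/-- Polynomial functions homogeneous of (topological) degree `2k`. -/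
def AdegN (k : ℕ) : Submodule ℝ (PolyRing V) where
  carrier := {f | ∀ (t : ℝ) (x : V), (f : V → ℝ) (t • x) = t ^ k * (f : V → ℝ) x}
  add_mem' := by intro f g hf hg t x; simp [hf t x, hg t x]; ring
  zero_mem' := by intro t x; simp
  smul_mem' := by intro c f hf t x; simp [hf t x]; ring

/-- The degree-`q` part `A^q` of `A•`, with linear forms in degree `2`
(so `A^q = 0` for odd `q`). -/
def Adeg (q : ℤ) : Submodule ℝ (PolyRing V) :=
  ⨆ (k : ℕ) (_ : q = 2 * k), AdegN V k

/-- Evaluation of a polynomial function at a point, as a ring homomorphism. -/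
def evalRH (x : V) : PolyRing V →+* ℝ :=
  (Pi.evalRingHom (fun _ : V => ℝ) x).comp (polyAlg V).val.toRingHom

/-- The maximal graded ideal `m = A^{>0}` of polynomial functions vanishing at the origin. -/
def mId : Ideal (PolyRing V) := RingHom.ker (evalRH V 0)

/-- The ideal of polynomial functions vanishing on a subset `s ⊆ V`;
for `s = σ` a cone, `A•/I(σ) = A•_σ = S•(V_σ*)`. -/
def vanishingIdeal (s : Set V) : Ideal (PolyRing V) :=
  RingHom.ker (Pi.ringHom (fun x : s => evalRH V x.1))

/-- `A•_σ`, realized as the quotient of `A•` by the functions vanishing on `σ`. -/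
abbrev coneRing (σ : Cone V) : Type := PolyRing V ⧸ vanishingIdeal V σ.carrier

/-! ## Graded `A•`-modules -/

/-- A graded `A•`-module (with real structure): an `A•`-module with an internal
`ℤ`-grading by real subspaces, compatible with the grading of `A•`. -/
structure GAMod where
  M : Type
  [acg : AddCommGroup M]
  [modA : Module (PolyRing V) M]
  [modR : Module ℝ M]
  [tower : IsScalarTower ℝ (PolyRing V) M]
  deg : ℤ → Submodule ℝ M
  internal : DirectSum.IsInternal deg
  smul_deg : ∀ (p q : ℤ), ∀ a ∈ Adeg V p, ∀ x ∈ deg q, a • x ∈ deg (p + q)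

attribute [instance] GAMod.acg GAMod.modA GAMod.modR GAMod.tower

variable {V}

/-- A homomorphism of graded `A•`-modules, homogeneous of degree 0. -/
structure GHom (M N : GAMod V) where
  toLin : M.M →ₗ[PolyRing V] N.M
  deg_mem : ∀ q : ℤ, ∀ x ∈ M.deg q, toLin x ∈ N.deg q

def GHom.id (M : GAMod V) : GHom M M := ⟨LinearMap.id, fun _ _ h => h⟩

def GHom.comp {M N P : GAMod V} (g : GHom N P) (f : GHom M N) : GHom M P :=
  ⟨g.toLin ∘ₗ f.toLin, fun q x hx => g.deg_mem q _ (f.deg_mem q x hx)⟩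

variable (V)

/-- `M` is (the `A•`-module underlying) a free `A•_σ`-module. -/
def FreeOverCone (σ : Cone V) (M : Type) [AddCommGroup M] [Module (PolyRing V) M] : Prop :=
  ∃ h : Module.IsTorsionBySet (PolyRing V) M (vanishingIdeal V σ.carrier),
    letI := h.module
    Module.Free (coneRing V σ) M

/-! ## Reduction modulo the maximal graded ideal -/

/-- The submodule `m·M`. -/
def mSub (M : Type) [AddCommGroup M] [Module (PolyRing V) M] :
    Submodule (PolyRing V) M := (mId V) • (⊤ : Submodule (PolyRing V) M)

/-- The reduction `M̄ = M/mM`. -/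
abbrev mRed (M : Type) [AddCommGroup M] [Module (PolyRing V) M] : Type := M ⧸ mSub V M

lemma mSub_le_comap {M N : Type} [AddCommGroup M] [Module (PolyRing V) M]
    [AddCommGroup N] [Module (PolyRing V) N] (f : M →ₗ[PolyRing V] N) :
    mSub V M ≤ (mSub V N).comap f := by
  rw [mSub, Submodule.smul_le]
  intro r hr x _
  simp only [Submodule.mem_comap, map_smul]
  exact Submodule.smul_mem_smul hr trivial

/-- The reduced map `M̄ → N̄` induced by an `A•`-linear map. -/
def mRedMap {M N : Type} [AddCommGroup M] [Module (PolyRing V) M]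
    [AddCommGroup N] [Module (PolyRing V) N] (f : M →ₗ[PolyRing V] N) :
    mRed V M →ₗ[PolyRing V] mRed V N :=
  Submodule.mapQ _ _ f (mSub_le_comap V f)

/-- The image in `M̄` of an `ℝ`-subspace of `M` (e.g. of a graded piece). -/
def mRedPiece {M : Type} [AddCommGroup M] [Module (PolyRing V) M] [Module ℝ M]
    [IsScalarTower ℝ (PolyRing V) M] (p : Submodule ℝ M) : Submodule ℝ (mRed V M) :=
  p.map ((mSub V M).mkQ.restrictScalars ℝ)

/-! ## Sheaves of graded `A•`-modules on a fan -/

open scoped Classical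

/-- The zero cone as an element of a fan. -/
def Fan.ozero {V : Type} [AddCommGroup V] [Module ℝ V] (Δ : Fan V) : Δ.cones :=
  ⟨zeroCone V, Δ.zero_mem⟩


variable {V}

/-- A sheaf of graded `A•`-modules on the fan space `Δ`, given (as the fan topology
dictates) by its stalks on the cones together with compatible restriction maps. -/
structure FanSheaf (Δ : Fan V) where
  stalk : Δ.cones → GAMod V
  res : ∀ σ τ : Δ.cones, Cone.IsFaceOf τ.1 σ.1 → GHom (stalk σ) (stalk τ)
  res_self : ∀ (σ : Δ.cones) (h : Cone.IsFaceOf σ.1 σ.1), (res σ σ h).toLin = LinearMap.id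
  res_comp : ∀ (σ τ υ : Δ.cones) (h1 : Cone.IsFaceOf τ.1 σ.1) (h2 : Cone.IsFaceOf υ.1 τ.1)
      (h3 : Cone.IsFaceOf υ.1 σ.1),
      (res τ υ h2).toLin ∘ₗ (res σ τ h1).toLin = (res σ υ h3).toLin

namespace FanSheaf

variable {Δ : Fan V} (F : FanSheaf Δ)

/-- The sections of `F` over a collection `Λ` of cones of `Δ` (e.g. a subfan):
compatible families of elements of the stalks over `Λ`, extended by zero. -/
def secSub (Λ : Set (Cone V)) :
    Submodule (PolyRing V) (∀ σ : Δ.cones, (F.stalk σ).M) where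
  carrier := { s | (∀ σ : Δ.cones, σ.1 ∉ Λ → s σ = 0) ∧
    ∀ (σ τ : Δ.cones), σ.1 ∈ Λ → τ.1 ∈ Λ → ∀ h : Cone.IsFaceOf τ.1 σ.1,
      (F.res σ τ h).toLin (s σ) = s τ }
  add_mem' := by
    rintro a b ⟨ha0, ha⟩ ⟨hb0, hb⟩
    refine ⟨fun σ hσ => by simp [ha0 σ hσ, hb0 σ hσ], fun σ τ hσ hτ h => ?_⟩
    simp [map_add, ha σ τ hσ hτ h, hb σ τ hσ hτ h]
  zero_mem' := ⟨fun _ _ => rfl, fun σ τ _ _ h => by simp⟩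
  smul_mem' := by
    rintro c a ⟨ha0, ha⟩
    refine ⟨fun σ hσ => by simp [ha0 σ hσ], fun σ τ hσ hτ h => ?_⟩
    simp [map_smul, ha σ τ hσ hτ h]

/-- The `A•`-module of sections of `F` over `Λ`. -/
abbrev Sec (Λ : Set (Cone V)) : Type := F.secSub Λ

/-- The global sections `E•(Δ)`. -/
abbrev globalSec : Type := F.Sec Δ.cones

/-- The degree-`q` part of the module of sections. -/
def secDeg (Λ : Set (Cone V)) (q : ℤ) : Submodule ℝ (F.Sec Λ) where
  carrier := { s | ∀ σ : Δ.cones, s.1 σ ∈ (F.stalk σ).deg q }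
  add_mem' := by intro a b ha hb σ; exact add_mem (ha σ) (hb σ)
  zero_mem' := fun σ => zero_mem _
  smul_mem' := by intro c a ha σ; exact Submodule.smul_mem _ c (ha σ)

/-- Restriction of sections to a smaller collection of cones. -/
def resSec (Λ' Λ : Set (Cone V)) (hΛ : Λ ⊆ Λ') : F.Sec Λ' →ₗ[PolyRing V] F.Sec Λ where
  toFun s := ⟨fun σ => if σ.1 ∈ Λ then s.1 σ else 0, by
    classical
    refine ⟨fun σ hσ => by simp [hσ], fun σ τ hσ hτ h => ?_⟩
    simp only [hσ, hτ, if_pos]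
    exact s.2.2 σ τ (hΛ hσ) (hΛ hτ) h⟩
  map_add' a b := by
    apply Subtype.ext; funext σ; by_cases h : σ.1 ∈ Λ <;> simp [h]
  map_smul' c a := by
    apply Subtype.ext; funext σ; by_cases h : σ.1 ∈ Λ <;> simp [h]

/-- A sheaf is flabby if all restrictions from global sections to subfans are surjective. -/
def Flabby : Prop :=
  ∀ Λ : Set (Cone V), ∀ h : Δ.IsSubfan Λ, Function.Surjective (F.resSec Δ.cones Λ h.1)

/-- The boundary fan `∂σ` of a cone of `Δ`, as a set of cones. -/
def bdFan (σ : Δ.cones) : Set (Cone V) := {τ : Cone V | τ.IsProperFaceOf σ.1}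

/-- The restriction map `E•_σ → E•_{∂σ}` from the stalk to the sections over the
boundary fan of `σ`. -/
def bdRes (σ : Δ.cones) : (F.stalk σ).M →ₗ[PolyRing V] F.Sec (bdFan σ) where
  toFun x := ⟨fun τ => if h : Cone.IsProperFaceOf τ.1 σ.1 then (F.res σ τ h.1).toLin x else 0, by
    refine ⟨fun τ hτ => by simp [bdFan] at hτ; simp [hτ], ?_⟩
    intro τ υ hτ hυ h
    simp only [bdFan, Set.mem_setOf_eq] at hτ hυ
    simp only [dif_pos hτ, dif_pos hυ]
    rw [← F.res_comp σ τ υ hτ.1 h hυ.1]; rfl⟩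
  map_add' a b := by
    apply Subtype.ext; funext τ
    by_cases h : Cone.IsProperFaceOf τ.1 σ.1 <;> simp [h]
  map_smul' c a := by
    apply Subtype.ext; funext τ
    by_cases h : Cone.IsProperFaceOf τ.1 σ.1 <;> simp [h]

/-- The reduced restriction map `Ē•_σ → Ē•_{∂σ}` modulo `m`. -/
def bdResRed (σ : Δ.cones) :
    mRed V (F.stalk σ).M →ₗ[PolyRing V] mRed V (F.Sec (bdFan σ)) :=
  mRedMap V (F.bdRes σ)

/-- Condition (N): `E•_o ≅ A•_o = ℝ•`, i.e. the stalk at the zero cone is the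
trivial one-dimensional graded module concentrated in degree `0`. -/
def CondN : Prop :=
  Module.IsTorsionBySet (PolyRing V) (F.stalk Δ.ozero).M (mId V : Set (PolyRing V)) ∧
  Module.finrank ℝ (F.stalk Δ.ozero).M = 1 ∧
  ∀ q : ℤ, q ≠ 0 → (F.stalk Δ.ozero).deg q = ⊥

/-- Condition (PF): each stalk `E•_σ` is a free `A•_σ`-module. -/
def CondPF : Prop := ∀ σ : Δ.cones, FreeOverCone V σ.1 (F.stalk σ).M

/-- Condition (LME): for each nonzero cone `σ`, the restriction `E•_σ → E•_{∂σ}`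
induces, modulo `m`, an isomorphism of graded real vector spaces. -/
def CondLME : Prop :=
  ∀ σ : Δ.cones, σ.1 ≠ zeroCone V → ∀ q : ℤ,
    Set.BijOn (F.bdResRed σ)
      (mRedPiece V ((F.stalk σ).deg q) : Set (mRed V (F.stalk σ).M))
      (mRedPiece V (M := F.Sec (bdFan σ)) (F.secDeg (bdFan σ) q) : Set (mRed V (F.Sec (bdFan σ))))

/-- A minimal extension sheaf on the fan `Δ`. -/
def IsMES : Prop := F.CondN ∧ F.CondPF ∧ F.CondLME

end FanSheaf

/-! ## Helper lemmas -/

lemma polyRing_noeth (V : Type) [AddCommGroup V] [Module ℝ V] [FiniteDimensional ℝ V] :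
    IsNoetherianRing (PolyRing V) := by
  have hfg : (polyAlg V).FG := by
    let b := Module.finBasis ℝ V
    refine Subalgebra.fg_def.2 ⟨Set.range (fun i => (fun x : V => b.repr x i)),
      Set.finite_range _, ?_⟩
    apply le_antisymm
    · apply Algebra.adjoin_mono
      rintro _ ⟨i, rfl⟩
      exact ⟨fun x y => by simp, fun c x => by simp⟩
    · apply Algebra.adjoin_le
      intro f hf
      have hf' : IsLinearMap ℝ f := hf
      have : f = ∑ i, f (b i) • (fun x : V => b.repr x i) := by
        funext x
        have h1 : hf'.mk' f x = ∑ i, b.repr x i • hf'.mk' f (b i) := by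
          conv_lhs => rw [← b.sum_repr x]
          simp only [map_sum, map_smul]
        simp only [IsLinearMap.mk'_apply] at h1
        simp only [Finset.sum_apply, Pi.smul_apply, smul_eq_mul] at h1 ⊢
        rw [h1]
        exact Finset.sum_congr rfl fun i _ => mul_comm _ _
      rw [this]
      exact Subalgebra.sum_mem _ fun i _ => Subalgebra.smul_mem _
        (Algebra.subset_adjoin (Set.mem_range_self i)) _
  have : Algebra.FiniteType ℝ (PolyRing V) := (Subalgebra.fg_iff_finiteType _).1 hfg
  exact Algebra.FiniteType.isNoetherianRing ℝ (PolyRing V)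

/-- the linear forms inside the polynomial ring -/
def linForms (V : Type) [AddCommGroup V] [Module ℝ V] : Set (PolyRing V) :=
  {a | IsLinearMap ℝ (a : V → ℝ)}

lemma mId_eq_span (V : Type) [AddCommGroup V] [Module ℝ V] :
    mId V = Ideal.span (linForms V) := by
  apply le_antisymm
  · have key : ∀ f (hf : f ∈ polyAlg V),
        (⟨f, hf⟩ : PolyRing V) - algebraMap ℝ (PolyRing V) (f 0) ∈ Ideal.span (linForms V) := by
      intro f hf
      induction hf using Algebra.adjoin_induction with
      | mem f hf =>
        have h0 : f 0 = 0 := (IsLinearMap.mk' f hf).map_zero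
        rw [h0, map_zero, sub_zero]
        exact Ideal.subset_span hf
      | algebraMap r =>
        convert Ideal.zero_mem _
        rw [sub_eq_zero]
        rfl
      | add f g hf hg h1 h2 =>
        convert Ideal.add_mem _ h1 h2 using 1
        apply Subtype.ext
        funext x
        simp
        ring
      | mul f g hf hg h1 h2 =>
        convert Ideal.add_mem _ (Ideal.mul_mem_right ⟨g, hg⟩ _ h1)
          (Ideal.mul_mem_left _ (algebraMap ℝ (PolyRing V) (f 0)) h2) using 1
        apply Subtype.ext
        funext x
        simp
        ring
    intro a ha
    have h0 : (a : V → ℝ) 0 = 0 := ha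
    have := key a.1 a.2
    rw [h0, map_zero, sub_zero] at this
    exact this
  · rw [Ideal.span_le]
    intro a ha
    exact (IsLinearMap.mk' _ ha).map_zero

lemma linForms_deg (V : Type) [AddCommGroup V] [Module ℝ V] (a : PolyRing V)
    (ha : a ∈ linForms V) : a ∈ Adeg V 2 := by
  have h1 : a ∈ AdegN V 1 := by
    intro t x
    have := (IsLinearMap.mk' _ ha).map_smul t x
    rw [pow_one]
    exact this
  exact Submodule.mem_iSup_of_mem 1 (Submodule.mem_iSup_of_mem (by norm_num) h1)

section proj
variable {V : Type} [AddCommGroup V] [Module ℝ V]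

lemma GAMod.exists_proj (M : GAMod V) : ∃ P : ℤ → M.M →ₗ[ℝ] M.M,
    (∀ q x, P q x ∈ M.deg q) ∧ (∀ q, ∀ x ∈ M.deg q, P q x = x) ∧
    (∀ p q, p ≠ q → ∀ x ∈ M.deg p, P q x = 0) := by
  classical
  letI := M.internal.chooseDecomposition
  refine ⟨fun q => (M.deg q).subtype ∘ₗ DirectSum.component ℝ ℤ (fun i => M.deg i) q ∘ₗ
    (DirectSum.decomposeLinearEquiv M.deg).toLinearMap, ?_, ?_, ?_⟩
  · intro q x
    exact Submodule.coe_mem _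
  · intro q x hx
    exact DirectSum.decompose_of_mem_same M.deg hx
  · intro p q hpq x hx
    exact DirectSum.decompose_of_mem_ne M.deg hx hpq

def GAMod.proj (M : GAMod V) (q : ℤ) : M.M →ₗ[ℝ] M.M := M.exists_proj.choose q

lemma GAMod.proj_mem (M : GAMod V) (q : ℤ) (x : M.M) : M.proj q x ∈ M.deg q :=
  M.exists_proj.choose_spec.1 q x

lemma GAMod.proj_same (M : GAMod V) (q : ℤ) (x : M.M) (hx : x ∈ M.deg q) : M.proj q x = x :=
  M.exists_proj.choose_spec.2.1 q x hx

lemma GAMod.proj_ne (M : GAMod V) (p q : ℤ) (h : p ≠ q) (x : M.M) (hx : x ∈ M.deg p) :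
    M.proj q x = 0 :=
  M.exists_proj.choose_spec.2.2 p q h x hx

lemma GAMod.deg_induction (M : GAMod V) {C : M.M → Prop} (x : M.M)
    (h1 : ∀ q, ∀ x ∈ M.deg q, C x) (h0 : C 0) (ha : ∀ x y, C x → C y → C (x + y)) : C x := by
  have hx : x ∈ ⨆ q, M.deg q := by
    rw [M.internal.submodule_iSup_eq_top]; trivial
  exact Submodule.iSup_induction M.deg (motive := C) hx h1 h0 ha

lemma GHom.proj_comm {M N : GAMod V} (f : GHom M N) (q : ℤ) (x : M.M) :
    f.toLin (M.proj q x) = N.proj q (f.toLin x) := by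
  induction x using M.deg_induction with
  | h1 p x hx =>
    by_cases h : p = q
    · subst h
      rw [M.proj_same _ _ hx, N.proj_same _ _ (f.deg_mem _ _ hx)]
    · rw [M.proj_ne p q h _ hx, N.proj_ne p q h _ (f.deg_mem _ _ hx), map_zero]
  | h0 => simp
  | ha x y hx hy => simp only [map_add, hx, hy]

lemma GAMod.proj_lin_smul (M : GAMod V) (a : PolyRing V) (ha : a ∈ linForms V) (q : ℤ)
    (x : M.M) : M.proj q (a • x) = a • M.proj (q - 2) x := by
  induction x using M.deg_induction with
  | h1 p x hx =>
    have hd := M.smul_deg 2 p a (linForms_deg V a ha) x hx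
    by_cases h : p = q - 2
    · have h' : 2 + p = q := by omega
      subst h
      rw [h'] at hd
      rw [M.proj_same _ _ hd, M.proj_same _ _ hx]
    · rw [M.proj_ne _ q (by omega) _ hd, M.proj_ne p _ h _ hx, smul_zero]
  | h0 => simp
  | ha x y hx hy => simp only [smul_add, map_add, hx, hy]

namespace FanSheaf
variable {Δ : Fan V} (F : FanSheaf Δ)

/-- degree projection on sections -/
def secProj (Λ : Set (Cone V)) (q : ℤ) : F.Sec Λ →ₗ[ℝ] F.Sec Λ where
  toFun s := ⟨fun σ => (F.stalk σ).proj q (s.1 σ), by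
    refine ⟨fun σ hσ => by
      change (F.stalk σ).proj q (s.1 σ) = 0
      rw [s.2.1 σ hσ, map_zero], fun σ τ hσ hτ h => ?_⟩
    rw [GHom.proj_comm, s.2.2 σ τ hσ hτ h]⟩
  map_add' a b := by
    apply Subtype.ext; funext σ; exact map_add _ _ _
  map_smul' c a := by
    apply Subtype.ext; funext σ; exact map_smul _ _ _

lemma secProj_mSub (Λ : Set (Cone V)) (q : ℤ) (s : F.Sec Λ) (hs : s ∈ mSub V (F.Sec Λ)) :
    F.secProj Λ q s ∈ mSub V (F.Sec Λ) := by
  have key : ∀ a ∈ mId V, ∀ n : F.Sec Λ, F.secProj Λ q (a • n) ∈ mSub V (F.Sec Λ) := by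
    intro a ha
    rw [mId_eq_span] at ha
    induction ha using Submodule.span_induction with
    | mem a ha =>
      intro n
      have : F.secProj Λ q (a • n) = a • F.secProj Λ (q - 2) n := by
        apply Subtype.ext; funext σ
        exact (F.stalk σ).proj_lin_smul a ha q _
      rw [this]
      exact Submodule.smul_mem_smul (by rw [mId_eq_span]; exact Ideal.subset_span ha) trivial
    | zero => intro n; rw [zero_smul, map_zero]; exact zero_mem _
    | add a b _ _ h1 h2 =>
      intro n
      rw [add_smul, map_add]; exact add_mem (h1 n) (h2 n)
    | smul b a _ h =>
      intro n
      rw [smul_eq_mul, mul_comm, mul_smul]; exact h _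
  refine Submodule.smul_induction_on hs (fun a ha n _ => key a ha n) fun x y hx hy => ?_
  rw [map_add]; exact add_mem hx hy

lemma sec_finite [FiniteDimensional ℝ V] (Λ : Set (Cone V))
    (h : ∀ σ : Δ.cones, σ.1 ∈ Λ → Module.Finite (PolyRing V) (F.stalk σ).M) :
    Module.Finite (PolyRing V) (F.Sec Λ) := by
  haveI := polyRing_noeth V
  haveI : Finite Δ.cones := Δ.finite
  haveI : ∀ σ : {σ : Δ.cones // σ.1 ∈ Λ}, Module.Finite (PolyRing V) (F.stalk σ.1).M :=
    fun σ => h σ.1 σ.2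
  let φ : F.Sec Λ →ₗ[PolyRing V] (∀ σ : {σ : Δ.cones // σ.1 ∈ Λ}, (F.stalk σ.1).M) :=
    { toFun := fun s σ => s.1 σ.1
      map_add' := fun _ _ => rfl
      map_smul' := fun _ _ => rfl }
  apply Module.Finite.of_injective φ
  intro s t hst
  apply Subtype.ext; funext σ
  by_cases hσ : σ.1 ∈ Λ
  · exact congrFun hst ⟨σ, hσ⟩
  · rw [s.2.1 σ hσ, t.2.1 σ hσ]

lemma bdRes_deg (σ : Δ.cones) (q : ℤ) (x : (F.stalk σ).M) (hx : x ∈ (F.stalk σ).deg q) :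
    F.bdRes σ x ∈ F.secDeg (bdFan σ) q := by
  intro τ
  change (if h : Cone.IsProperFaceOf τ.1 σ.1 then (F.res σ τ h.1).toLin x else 0) ∈ _
  split_ifs with h
  · exact (F.res σ τ h.1).deg_mem q x hx
  · exact zero_mem _

lemma secProj_bdRes (σ : Δ.cones) (q : ℤ) (x : (F.stalk σ).M) :
    F.secProj (bdFan σ) q (F.bdRes σ x) = F.bdRes σ ((F.stalk σ).proj q x) := by
  apply Subtype.ext; funext τ
  change (F.stalk τ).proj q (if h : Cone.IsProperFaceOf τ.1 σ.1 then
    (F.res σ τ h.1).toLin x else 0) = if h : Cone.IsProperFaceOf τ.1 σ.1 then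
    (F.res σ τ h.1).toLin ((F.stalk σ).proj q x) else 0
  split_ifs with h
  · rw [GHom.proj_comm]
  · simp

lemma bdResRed_injective (hF : F.CondLME) (σ : Δ.cones) (hσ : σ.1 ≠ zeroCone V) :
    Function.Injective (F.bdResRed σ) := by
  rw [injective_iff_map_eq_zero]
  intro y hy
  obtain ⟨x, rfl⟩ := Submodule.mkQ_surjective _ y
  have hx : F.bdRes σ x ∈ mSub V (F.Sec (bdFan σ)) :=
    (Submodule.Quotient.mk_eq_zero _).1 hy
  have hq : ∀ q, (F.stalk σ).proj q x ∈ mSub V (F.stalk σ).M := by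
    intro q
    have h1 := F.secProj_mSub _ q _ hx
    rw [secProj_bdRes] at h1
    have h2 : F.bdResRed σ ((mSub V (F.stalk σ).M).mkQ ((F.stalk σ).proj q x)) = 0 :=
      (Submodule.Quotient.mk_eq_zero _).2 h1
    have h3 := (hF σ hσ q).injOn (x₁ := (mSub V (F.stalk σ).M).mkQ ((F.stalk σ).proj q x))
      (x₂ := 0) ⟨_, (F.stalk σ).proj_mem q x, rfl⟩ (zero_mem _) (h2.trans (map_zero _).symm)
    exact (Submodule.Quotient.mk_eq_zero _).1 h3
  have hsum : ∃ s : Finset ℤ, x = ∑ q ∈ s, (F.stalk σ).proj q x := by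
    classical
    have hall : ∃ s : Finset ℤ, ∀ t, s ⊆ t → x = ∑ q ∈ t, (F.stalk σ).proj q x := by
      clear hx hq hy
      induction x using (F.stalk σ).deg_induction with
      | h1 p x hx =>
        refine ⟨{p}, fun t ht => ?_⟩
        rw [Finset.sum_eq_single_of_mem p (ht (Finset.mem_singleton_self p))
          (fun q _ hqp => (F.stalk σ).proj_ne p q hqp.symm x hx), (F.stalk σ).proj_same _ _ hx]
      | h0 => exact ⟨∅, fun t _ => by simp⟩
      | ha x y hx hy =>
        obtain ⟨s, hs⟩ := hx
        obtain ⟨s', hs'⟩ := hy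
        refine ⟨s ∪ s', fun t ht => ?_⟩
        simp only [map_add, Finset.sum_add_distrib]
        rw [← hs t (Finset.union_subset_left ht), ← hs' t (Finset.union_subset_right ht)]
    obtain ⟨s, hs⟩ := hall
    exact ⟨s, hs s subset_rfl⟩
  obtain ⟨s, hs⟩ := hsum
  refine (Submodule.Quotient.mk_eq_zero _).2 ?_
  rw [hs]
  exact Submodule.sum_mem _ fun q _ => hq q

end FanSheaf

lemma Cone.zero_mem_carrier (σ : Cone V) : (0 : V) ∈ σ.carrier := by
  obtain ⟨s, hs⟩ := σ.isPoly
  rw [hs]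
  exact ⟨0, fun _ _ => le_rfl, by simp⟩

lemma free_finite (σ : Cone V) (M : Type) [AddCommGroup M] [Module (PolyRing V) M]
    (hfree : FreeOverCone V σ M) (hfin : Module.Finite (PolyRing V) (mRed V M)) :
    Module.Finite (PolyRing V) M := by
  classical
  obtain ⟨h, hf⟩ := hfree
  letI := h.module
  haveI : IsScalarTower (PolyRing V) (coneRing V σ) M := h.isScalarTower
  haveI : Module.Free (coneRing V σ) M := hf
  let b := Module.Free.chooseBasis (coneRing V σ) M
  -- evaluation at the origin
  let ev : coneRing V σ →+* ℝ := Ideal.Quotient.lift _ (evalRH V 0) (by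
    intro a ha
    exact congrFun (show Pi.ringHom (fun x : σ.carrier => evalRH V x.1) a = 0 from ha)
      ⟨0, σ.zero_mem_carrier⟩)
  have hsm : ∀ (a : PolyRing V) (x : M), a • x = (Ideal.Quotient.mk _ a : coneRing V σ) • x :=
    fun a x => rfl
  have hm : ∀ x ∈ mSub V M, ∀ i, ev (b.repr x i) = 0 := by
    intro x hx i
    refine Submodule.smul_induction_on hx (fun a ha n _ => ?_) fun x y hx hy => ?_
    · rw [hsm, map_smul, Finsupp.smul_apply, smul_eq_mul, map_mul]
      have : ev (Ideal.Quotient.mk _ a) = 0 := ha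
      rw [this, zero_mul]
    · rw [map_add, Finsupp.add_apply, map_add, hx, hy, add_zero]
  obtain ⟨S, hS⟩ := hfin.fg_top
  choose g hg using Submodule.mkQ_surjective (mSub V M)
  let J : Finset _ := S.biUnion fun y => (b.repr (g y)).support
  have hJ : ∀ i, i ∈ J := by
    intro i
    by_contra hi
    have hz : ∀ y : mRed V M, ∀ x : M, (mSub V M).mkQ x = y → ev (b.repr x i) = 0 := by
      intro y
      have hy : y ∈ Submodule.span (PolyRing V) (S : Set (mRed V M)) := by rw [hS]; trivial
      suffices hex : ∃ x : M, (mSub V M).mkQ x = y ∧ ev (b.repr x i) = 0 by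
        obtain ⟨x, hx, hx0⟩ := hex
        intro x' hx'
        have hd : x' - x ∈ mSub V M := by
          rw [← Submodule.Quotient.mk_eq_zero]
          change (mSub V M).mkQ (x' - x) = 0
          rw [map_sub, hx, hx', sub_self]
        have := hm _ hd i
        rw [map_sub, Finsupp.sub_apply, map_sub, hx0, sub_zero] at this
        exact this
      induction hy using Submodule.span_induction with
      | mem y hy =>
        refine ⟨g y, hg y, ?_⟩
        have : b.repr (g y) i = 0 := by
          by_contra hne
          exact hi (Finset.mem_biUnion.2 ⟨y, hy, Finsupp.mem_support_iff.2 hne⟩)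
        rw [this, map_zero]
      | zero => exact ⟨0, map_zero _, by simp⟩
      | add y z _ _ h1 h2 =>
        obtain ⟨x, hx, hx0⟩ := h1
        obtain ⟨x', hx', hx0'⟩ := h2
        exact ⟨x + x', by rw [map_add, hx, hx'], by
          rw [map_add, Finsupp.add_apply, map_add, hx0, hx0', add_zero]⟩
      | smul a y _ h1 =>
        obtain ⟨x, hx, hx0⟩ := h1
        exact ⟨a • x, by rw [map_smul, hx], by
          rw [hsm, map_smul, Finsupp.smul_apply, smul_eq_mul, map_mul, hx0, mul_zero]⟩
    have := hz _ (b i) rfl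
    rw [b.repr_self, Finsupp.single_eq_same, map_one] at this
    exact one_ne_zero this
  haveI : Finite (Module.Free.ChooseBasisIndex (coneRing V σ) M) :=
    Set.finite_univ_iff.1 (J.finite_toSet.subset fun i _ => hJ i)
  haveI : Module.Finite (coneRing V σ) M := Module.Finite.of_basis b
  exact Module.Finite.trans (coneRing V σ) M

lemma stalk_finite [FiniteDimensional ℝ V] {Δ : Fan V} (F : FanSheaf Δ) (hF : F.IsMES)
    (σ : Δ.cones) : Module.Finite (PolyRing V) (F.stalk σ).M := by
  haveI : Finite Δ.cones := Δ.finite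
  have wf : WellFounded (fun τ σ : Δ.cones => τ.1.carrier ⊂ σ.1.carrier) := by
    haveI : IsTrans Δ.cones (fun τ σ : Δ.cones => τ.1.carrier ⊂ σ.1.carrier) :=
      ⟨fun _ _ _ h1 h2 => h1.trans h2⟩
    haveI : Std.Irrefl (fun τ σ : Δ.cones => τ.1.carrier ⊂ σ.1.carrier) :=
      ⟨fun _ h => (ssubset_irrefl _ h)⟩
    exact Finite.wellFounded_of_trans_of_irrefl _
  induction σ using wf.induction with
  | h σ ih =>
  by_cases hσ : σ.1 = zeroCone V
  · have : σ = Δ.ozero := Subtype.ext hσ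
    subst this
    haveI : Module.Finite ℝ (F.stalk Δ.ozero).M :=
      Module.finite_of_finrank_pos (by rw [hF.1.2.1]; exact one_pos)
    exact Module.Finite.of_restrictScalars_finite ℝ (PolyRing V) _
  · apply free_finite σ.1 _ (hF.2.1 σ)
    haveI := polyRing_noeth V
    haveI : Module.Finite (PolyRing V) (F.Sec (FanSheaf.bdFan σ)) := by
      apply F.sec_finite
      intro τ hτ
      apply ih
      obtain ⟨⟨f, _, hf⟩, hne⟩ := hτ
      refine ssubset_of_subset_of_ne (hf ▸ Set.inter_subset_left) fun he => hne ?_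
      obtain ⟨⟨c, _, _⟩, _⟩ := τ
      obtain ⟨⟨c', _, _⟩, _⟩ := σ
      simp only at he
      subst he
      rfl
    exact Module.Finite.of_injective _ (F.bdResRed_injective hF.2.2 σ hσ)

end proj

/-- For a minimal extension sheaf `E•` on a fan `Δ`, the stalks `E•_σ` and the modules
of sections `E•_Λ = E•(Λ)` over subfans are finitely generated `A•`-modules. -/
theorem mes_stalks_and_sections_finitely_generated
    {V : Type} [AddCommGroup V] [Module ℝ V] [FiniteDimensional ℝ V]
    {Δ : Fan V} (F : FanSheaf Δ) (hF : F.IsMES) :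
    (∀ σ : Δ.cones, Module.Finite (PolyRing V) (F.stalk σ).M) ∧
    (∀ Λ : Set (Cone V), Δ.IsSubfan Λ → Module.Finite (PolyRing V) (F.Sec Λ)) := by
  exact ⟨fun σ => stalk_finite F hF σ,
    fun Λ _ => F.sec_finite Λ fun σ _ => stalk_finite F hF σ⟩

end
end

section
/- If E• and F• are two minimal extension sheaves on a fan Δ, then every isomorphism E•_o ≅ ℝ ≅ F•_o extends to an isomorphism E• ≅ F• of sheaves of graded A•-modules; moreover, if Δ is simplicial, this extension is unique. -/
open Module Function

set_option synthInstance.maxHeartbeats 1000000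
set_option maxHeartbeats 1000000
set_option maxSynthPendingDepth 3

noncomputable section

variable (V : Type) [AddCommGroup V] [Module ℝ V]

variable {V}

variable (V)

/-! ## Sheaves of graded `A•`-modules on a fan -/

open scoped Classical

variable {V}

/-! ## Quasi-convexity, boundary sections, and Poincaré polynomials -/

section

variable {V : Type} [AddCommGroup V] [Module ℝ V]

/-- A fan is quasi-convex if the global sections of a minimal extension sheaf on it
form a free `A•`-module. -/
def Fan.QuasiConvex (Δ : Fan V) : Prop :=
  ∀ F : FanSheaf Δ, F.IsMES → Module.Free (PolyRing V) F.globalSec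

lemma Fan.boundary_subset [TopologicalSpace V] (Δ : Fan V) : Δ.boundary ⊆ Δ.cones :=
  fun _ h => h.1

/-- The module `E•_{(Δ,∂Δ)}` of global sections vanishing on the boundary subfan. -/
def FanSheaf.relSec [TopologicalSpace V] {Δ : Fan V} (F : FanSheaf Δ) :
    Submodule (PolyRing V) F.globalSec :=
  LinearMap.ker (F.resSec Δ.cones Δ.boundary (Fan.boundary_subset Δ))

/-- The degree-`q` part of `E•_{(Δ,∂Δ)}`. -/
def FanSheaf.relDeg [TopologicalSpace V] {Δ : Fan V} (F : FanSheaf Δ) (q : ℤ) :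
    Submodule ℝ F.relSec :=
  (F.secDeg Δ.cones q).comap ((F.relSec.subtype).restrictScalars ℝ)

/-- The polynomial `Σ_q d(q)·t^q` associated with a (finitely supported) dimension
function. -/
def poincareOf (d : ℕ → ℕ) : Polynomial ℝ :=
  if h : (Function.support d).Finite then ∑ q ∈ h.toFinset, (d q : ℝ) • Polynomial.X ^ q
  else 0

/-- The local Poincaré polynomial `P_σ(t) = Σ_q dim Ē^q_σ · t^q`. -/
def FanSheaf.localP {Δ : Fan V} (F : FanSheaf Δ) (σ : Δ.cones) : Polynomial ℝ :=
  poincareOf fun q => Module.finrank ℝ (mRedPiece V ((F.stalk σ).deg q))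

/-- The global Poincaré polynomial `P_Δ(t) = Σ_q dim Ē^q_Δ · t^q`. -/
def FanSheaf.globalP {Δ : Fan V} (F : FanSheaf Δ) : Polynomial ℝ :=
  poincareOf fun q =>
    Module.finrank ℝ (mRedPiece V (M := F.globalSec) (F.secDeg Δ.cones q))

/-- The relative Poincaré polynomial `P_{(Δ,∂Δ)}(t)`. -/
def FanSheaf.relP [TopologicalSpace V] {Δ : Fan V} (F : FanSheaf Δ) : Polynomial ℝ :=
  poincareOf fun q =>
    Module.finrank ℝ (mRedPiece V (M := F.relSec) (F.relDeg q))

end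

/-! ## Morphisms of sheaves -/

section

variable {V : Type} [AddCommGroup V] [Module ℝ V] {Δ : Fan V}

/-- A homomorphism of sheaves of graded `A•`-modules on `Δ`. -/
structure SheafHom (F G : FanSheaf Δ) where
  app : ∀ σ : Δ.cones, GHom (F.stalk σ) (G.stalk σ)
  comm : ∀ (σ τ : Δ.cones) (h : Cone.IsFaceOf τ.1 σ.1),
    (G.res σ τ h).toLin ∘ₗ (app σ).toLin = (app τ).toLin ∘ₗ (F.res σ τ h).toLin

/-- An isomorphism of sheaves of graded `A•`-modules: a homomorphism which is
stalkwise bijective. -/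
def SheafHom.IsIso {F G : FanSheaf Δ} (Φ : SheafHom F G) : Prop :=
  ∀ σ : Δ.cones, Function.Bijective (Φ.app σ).toLin

/-- Two sheaves on `Δ` are isomorphic. -/
def SheafIso (F G : FanSheaf Δ) : Prop := ∃ Φ : SheafHom F G, Φ.IsIso

end


/-! ## Proof: homogeneous components -/

section MesProof

namespace MesProof

variable {V : Type} [AddCommGroup V] [Module ℝ V]

/-- The degree-`q` component of an element of a graded module. -/
def comp (M : GAMod V) (q : ℤ) : M.M →ₗ[ℝ] M.M :=
  letI := M.internal.chooseDecomposition
  (M.deg q).subtype ∘ₗ DirectSum.component ℝ ℤ (fun i => M.deg i) q ∘ₗ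
    (DirectSum.decomposeLinearEquiv M.deg).toLinearMap

lemma comp_mem (M : GAMod V) (q : ℤ) (x : M.M) : comp M q x ∈ M.deg q := by
  simp [comp]

lemma comp_same (M : GAMod V) {q : ℤ} {x : M.M} (hx : x ∈ M.deg q) : comp M q x = x := by
  letI := M.internal.chooseDecomposition
  exact DirectSum.decompose_of_mem_same M.deg hx

lemma comp_ne (M : GAMod V) {p q : ℤ} {x : M.M} (hx : x ∈ M.deg p) (h : p ≠ q) :
    comp M q x = 0 := by
  letI := M.internal.chooseDecomposition
  exact DirectSum.decompose_of_mem_ne M.deg hx h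

lemma hom_induction (M : GAMod V) {P : M.M → Prop} (h0 : P 0)
    (hadd : ∀ x y, P x → P y → P (x + y)) (hh : ∀ q, ∀ x ∈ M.deg q, P x) (x : M.M) : P x := by
  letI := M.internal.chooseDecomposition
  exact DirectSum.Decomposition.inductionOn M.deg h0 (fun {i} m => hh i m m.2) hadd x

lemma comp_sum (M : GAMod V) (x : M.M) :
    ∃ T : Finset ℤ, ∀ T' : Finset ℤ, T ⊆ T' → ∑ q ∈ T', comp M q x = x := by
  induction x using hom_induction M with
  | h0 => exact ⟨∅, fun T' _ => by simp⟩
  | hadd x y hx hy =>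
    obtain ⟨T, hT⟩ := hx
    obtain ⟨S, hS⟩ := hy
    refine ⟨T ∪ S, fun T' h => ?_⟩
    simp only [map_add, Finset.sum_add_distrib]
    rw [hT T' (Finset.union_subset_left h), hS T' (Finset.union_subset_right h)]
  | hh q x hx =>
    refine ⟨{q}, fun T' h => ?_⟩
    rw [Finset.sum_eq_single q, comp_same M hx]
    · intro b _ hb
      exact comp_ne M hx hb.symm
    · intro hq
      exact absurd (h (Finset.mem_singleton_self q)) hq

lemma comp_hom {M N : GAMod V} (f : GHom M N) (q : ℤ) (x : M.M) :
    comp N q (f.toLin x) = f.toLin (comp M q x) := by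
  induction x using hom_induction M with
  | h0 => simp
  | hadd x y hx hy => simp [hx, hy]
  | hh p x hx =>
    by_cases h : p = q
    · subst h
      rw [comp_same M hx, comp_same N (f.deg_mem p x hx)]
    · rw [comp_ne M hx h, comp_ne N (f.deg_mem p x hx) h, map_zero]

lemma comp_smul (M : GAMod V) {p : ℤ} {a : PolyRing V} (ha : a ∈ Adeg V p) (q : ℤ) (x : M.M) :
    comp M (p + q) (a • x) = a • comp M q x := by
  induction x using hom_induction M with
  | h0 => simp
  | hadd x y hx hy => simp [hx, hy]
  | hh r x hx =>
    by_cases h : r = q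
    · subst h
      rw [comp_same M hx, comp_same M (M.smul_deg p r a ha x hx)]
    · rw [comp_ne M hx h, comp_ne M (M.smul_deg p r a ha x hx) (by simpa using h), smul_zero]

lemma AdegN_le (k : ℕ) : AdegN V k ≤ Adeg V (2 * k) :=
  le_iSup₂_of_le (f := fun (j : ℕ) (_ : (2 * k : ℤ) = 2 * j) => AdegN V j) k rfl le_rfl

/-- Every polynomial function is a sum of homogeneous ones. -/
lemma iSup_AdegN : (⨆ k, AdegN V k) = ⊤ := by
  have h1 : (1 : PolyRing V) ∈ AdegN V 0 := by intro t x; simp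
  have hmul : ∀ i j : ℕ, ∀ a ∈ AdegN V i, ∀ b ∈ AdegN V j, a * b ∈ AdegN V (i + j) := by
    intro i j a ha b hb t x
    have := ha t x
    have := hb t x
    simp only [MulMemClass.coe_mul, Pi.mul_apply, *]
    ring
  rw [eq_top_iff]
  rintro ⟨f, hf⟩ -
  refine Algebra.adjoin_induction (p := fun f hf => (⟨f, hf⟩ : PolyRing V) ∈ ⨆ k, AdegN V k)
    ?_ ?_ ?_ ?_ hf
  · intro x hx
    refine Submodule.mem_iSup_of_mem 1 ?_
    intro t y
    have hx' : IsLinearMap ℝ x := hx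
    simp [hx'.map_smul]
  · intro r
    refine Submodule.mem_iSup_of_mem 0 ?_
    intro t y
    simp
  · intro x y hx hy hx' hy'
    exact add_mem hx' hy'
  · intro x y hx hy hx' hy'
    change (⟨x, hx⟩ : PolyRing V) * ⟨y, hy⟩ ∈ _
    refine Submodule.iSup_induction (AdegN V) (motive := fun a => a * (⟨y, hy⟩ : PolyRing V) ∈ ⨆ k, AdegN V k) hx' ?_ ?_ ?_
    · intro i a ha
      refine Submodule.iSup_induction (AdegN V) (motive := fun b => a * b ∈ ⨆ k, AdegN V k) hy' ?_ ?_ ?_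
      · intro j b hb
        exact Submodule.mem_iSup_of_mem (i + j) (hmul i j a ha b hb)
      · simp
      · intro b c hb hc
        rw [mul_add]; exact add_mem hb hc
    · simp
    · intro b c hb hc
      rw [add_mul]; exact add_mem hb hc

lemma poly_induction {P : PolyRing V → Prop} (h0 : P 0)
    (hadd : ∀ x y, P x → P y → P (x + y)) (hh : ∀ k, ∀ x ∈ AdegN V k, P x) (x : PolyRing V) :
    P x :=
  Submodule.iSup_induction (AdegN V) (motive := P)
    (by rw [iSup_AdegN]; trivial) hh h0 hadd

lemma mem_mId (a : PolyRing V) : a ∈ mId V ↔ (a : V → ℝ) 0 = 0 := Iff.rfl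

lemma AdegN_mem_mId {k : ℕ} (hk : k ≠ 0) {a : PolyRing V} (ha : a ∈ AdegN V k) : a ∈ mId V := by
  rw [mem_mId]
  have := ha 0 0
  simpa [hk] using this

lemma m_induction {P : PolyRing V → Prop} (h0 : P 0)
    (hadd : ∀ x y, P x → P y → P (x + y)) (hh : ∀ k, k ≠ 0 → ∀ x ∈ AdegN V k, P x)
    (x : PolyRing V) (hx : x ∈ mId V) : P x := by
  have key : ∀ x : PolyRing V, ∃ c y : PolyRing V, c ∈ AdegN V 0 ∧ y ∈ mId V ∧ P y ∧ x = c + y := by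
    intro x
    induction x using poly_induction with
    | h0 => exact ⟨0, 0, zero_mem _, zero_mem _, h0, by simp⟩
    | hadd x y hx hy =>
      obtain ⟨c, z, hc, hz, hP, rfl⟩ := hx
      obtain ⟨c', z', hc', hz', hP', rfl⟩ := hy
      exact ⟨c + c', z + z', add_mem hc hc', add_mem hz hz', hadd _ _ hP hP', by ring⟩
    | hh k x hx =>
      by_cases hk : k = 0
      · subst hk
        exact ⟨x, 0, hx, zero_mem _, h0, by simp⟩
      · exact ⟨0, x, zero_mem _, AdegN_mem_mId hk hx, hh k hk x hx, by simp⟩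
  obtain ⟨c, y, hc, hy, hP, rfl⟩ := key x
  have hc0 : c = 0 := by
    have h2 : c ∈ mId V := by simpa using sub_mem hx hy
    rw [mem_mId] at h2
    apply Subtype.ext
    funext v
    have := hc 0 v
    simp only [zero_smul, pow_zero, one_mul] at this
    rw [← this, h2]; rfl
  rw [hc0, zero_add]; exact hP

lemma mSub_comp (M : GAMod V) (q : ℤ) {x : M.M} (hx : x ∈ mSub V M.M) :
    comp M q x ∈ mSub V M.M := by
  refine Submodule.smul_induction_on hx ?_ ?_
  · intro a ha y _
    refine m_induction (P := fun a => comp M q (a • y) ∈ mSub V M.M) ?_ ?_ ?_ a ha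
    · simp
    · intro b c hb hc
      rw [add_smul, map_add]; exact add_mem hb hc
    · intro k hk b hb
      have := comp_smul M (AdegN_le k hb) (q - 2 * k) y
      rw [add_sub_cancel] at this
      rw [this]
      exact Submodule.smul_mem_smul (AdegN_mem_mId hk hb) trivial
  · intro y z hy hz
    rw [map_add]; exact add_mem hy hz

lemma comp_m_smul (M : GAMod V) {q : ℤ} {x : M.M} (hx : x ∈ M.deg q) {a : PolyRing V}
    (ha : a ∈ mId V) : comp M q (a • x) = 0 := by
  refine m_induction (P := fun a => comp M q (a • x) = 0) ?_ ?_ ?_ a ha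
  · simp
  · intro b c hb hc
    rw [add_smul, map_add, hb, hc, add_zero]
  · intro k hk b hb
    exact comp_ne M (M.smul_deg _ q b (AdegN_le k hb) x hx) (by simpa using hk)

lemma homog_of_gens (M : GAMod V) (N : Submodule (PolyRing V) M.M)
    (hN : ∀ x ∈ N, ∀ q, comp M q x ∈ N) (h : ∀ q, ∀ x ∈ M.deg q, x ∈ N) : N = ⊤ := by
  rw [eq_top_iff]
  intro x _
  induction x using hom_induction M with
  | h0 => exact zero_mem _
  | hadd x y hx hy => exact add_mem (hx trivial) (hy trivial)
  | hh q x hx => exact h q x hx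

/-- Graded Nakayama lemma. -/
lemma graded_nakayama (M : GAMod V) [Module.Finite (PolyRing V) M.M]
    (N : Submodule (PolyRing V) M.M) (hN : ∀ x ∈ N, ∀ q, comp M q x ∈ N)
    (h : N ⊔ mSub V M.M = ⊤) : N = ⊤ := by
  have hle : (⊤ : Submodule (PolyRing V) (M.M ⧸ N)) ≤ mId V • ⊤ := by
    intro y _
    obtain ⟨x, rfl⟩ := N.mkQ_surjective y
    have hx : x ∈ N ⊔ mSub V M.M := by rw [h]; trivial
    obtain ⟨n, hn, z, hz, rfl⟩ := Submodule.mem_sup.1 hx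
    rw [map_add]
    have : N.mkQ n = 0 := by simpa using hn
    rw [this, zero_add]
    have h3 := Submodule.mem_map_of_mem (f := N.mkQ) hz
    rw [mSub, Submodule.map_smul''] at h3
    exact Submodule.smul_mono le_rfl le_top h3
  obtain ⟨r, hr, hr'⟩ := Submodule.exists_sub_one_mem_and_smul_eq_zero_of_fg_of_le_smul (mId V)
    (⊤ : Submodule (PolyRing V) (M.M ⧸ N)) Module.Finite.fg_top hle
  refine homog_of_gens M N hN ?_
  intro q x hx
  have h1 : r • x ∈ N := by
    have := hr' (N.mkQ x) trivial
    rw [← map_smul] at this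
    exact (Submodule.Quotient.mk_eq_zero N).1 this
  have h2 := hN _ h1 q
  have h3 : r • x = (r - 1) • x + x := by rw [sub_smul, one_smul]; abel
  rw [h3, map_add, comp_m_smul M hx hr, comp_same M hx, zero_add] at h2
  exact h2

/-- The degree-zero part of a linear map. -/
lemma exists_deg_zero {M N P : GAMod V} (ψ : M.M →ₗ[PolyRing V] N.M) (g : GHom N P) (h : GHom M P)
    (hψ : g.toLin ∘ₗ ψ = h.toLin) : ∃ χ : GHom M N, g.toLin ∘ₗ χ.toLin = h.toLin := by
  letI := M.internal.chooseDecomposition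
  let χ₀ : M.M →ₗ[ℝ] N.M :=
    DirectSum.toModule ℝ ℤ N.M
      (fun q => comp N q ∘ₗ (ψ.restrictScalars ℝ) ∘ₗ (M.deg q).subtype) ∘ₗ
    (DirectSum.decomposeLinearEquiv M.deg).toLinearMap
  have hχ : ∀ q, ∀ x ∈ M.deg q, χ₀ x = comp N q (ψ x) := by
    intro q x hx
    simp only [χ₀, LinearMap.comp_apply, LinearEquiv.coe_coe, DirectSum.decomposeLinearEquiv_apply]
    rw [DirectSum.decompose_of_mem M.deg hx]
    erw [DirectSum.toModule_lof]
    rfl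
  have hsm : ∀ (a : PolyRing V) (x : M.M), χ₀ (a • x) = a • χ₀ x := by
    intro a x
    induction x using hom_induction M with
    | h0 => simp
    | hadd x y hx hy => simp [hx, hy]
    | hh q x hx =>
      induction a using poly_induction with
      | h0 => simp
      | hadd a b ha hb => simp [add_smul, ha, hb]
      | hh k a ha =>
        rw [hχ q x hx, hχ _ _ (M.smul_deg _ q a (AdegN_le k ha) x hx), map_smul,
          comp_smul N (AdegN_le k ha)]
  refine ⟨⟨{ toFun := χ₀, map_add' := map_add χ₀, map_smul' := hsm }, ?_⟩, ?_⟩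
  · intro q x hx
    change χ₀ x ∈ _
    rw [hχ q x hx]; exact comp_mem N q _
  · ext x
    change g.toLin (χ₀ x) = h.toLin x
    induction x using hom_induction M with
    | h0 => simp
    | hadd x y hx hy => simp [hx, hy]
    | hh q x hx =>
      rw [hχ q x hx, ← comp_hom, ← LinearMap.comp_apply, hψ, comp_same P (h.deg_mem q x hx)]


/-! ### Noetherianity, free modules -/

lemma noeth [FiniteDimensional ℝ V] : IsNoetherianRing (PolyRing V) := by
  apply isNoetherianRing_of_fg
  let b := Module.finBasis ℝ V
  refine ⟨Finset.univ.image (fun i => (fun v => b.repr v i : V → ℝ)), ?_⟩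
  apply le_antisymm
  · apply Algebra.adjoin_mono
    intro f hf
    simp only [Finset.coe_image, Finset.coe_univ, Set.image_univ, Set.mem_range] at hf
    obtain ⟨i, rfl⟩ := hf
    exact ⟨fun x y => by simp, fun c x => by simp⟩
  · apply Algebra.adjoin_le
    intro f hf
    have hf' : IsLinearMap ℝ f := hf
    have : f = ∑ i, f (b i) • (fun v => b.repr v i : V → ℝ) := by
      funext v
      have h1 : hf'.mk' f v = hf'.mk' f (∑ i, b.repr v i • b i) := by rw [b.sum_repr]
      rw [map_sum] at h1
      simp only [map_smul, IsLinearMap.mk'_apply] at h1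
      rw [h1]
      simp [mul_comm]
    rw [this]
    refine sum_mem fun i _ => Subalgebra.smul_mem _ (Algebra.subset_adjoin ?_) _
    simp

lemma zero_mem_cone (σ : Cone V) : (0 : V) ∈ σ.carrier := by
  obtain ⟨s, hs⟩ := σ.isPoly
  rw [hs]
  exact ⟨0, by simp, by simp⟩

lemma mem_van {s : Set V} {a : PolyRing V} :
    a ∈ vanishingIdeal V s ↔ ∀ x ∈ s, (a : V → ℝ) x = 0 := by
  rw [vanishingIdeal, RingHom.mem_ker]
  constructor
  · intro h x hx
    exact congrFun h ⟨x, hx⟩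
  · intro h
    funext x
    exact h x.1 x.2

lemma van_le (σ : Cone V) : vanishingIdeal V σ.carrier ≤ mId V := by
  intro a ha
  exact mem_van.1 ha 0 (zero_mem_cone σ)

lemma free_lift {σ : Cone V} {M N P : Type} [AddCommGroup M] [Module (PolyRing V) M]
    [AddCommGroup N] [Module (PolyRing V) N] [AddCommGroup P] [Module (PolyRing V) P]
    (hM : FreeOverCone V σ M) (hN : Module.IsTorsionBySet (PolyRing V) N (vanishingIdeal V σ.carrier))
    (p : N →ₗ[PolyRing V] P) (hp : Function.Surjective p) (f : M →ₗ[PolyRing V] P) :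
    ∃ ψ : M →ₗ[PolyRing V] N, p ∘ₗ ψ = f := by
  obtain ⟨hT, hfree⟩ := hM
  let _ := hT.module
  let _ := hN.module
  have _ : Module.Free (coneRing V σ) M := hfree
  have _ : IsScalarTower (PolyRing V) (coneRing V σ) M := hT.isScalarTower
  have _ : IsScalarTower (PolyRing V) (coneRing V σ) N := hN.isScalarTower
  let b := Module.Free.chooseBasis (coneRing V σ) M
  choose y hy using fun i => hp (f (b i))
  let ψ₀ : M →ₗ[coneRing V σ] N := b.constr ℕ y
  refine ⟨ψ₀.restrictScalars (PolyRing V), ?_⟩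
  ext x
  have hx : x ∈ Submodule.span (coneRing V σ) (Set.range b) := by rw [b.span_eq]; trivial
  induction hx using Submodule.span_induction with
  | mem x h =>
    obtain ⟨i, rfl⟩ := h
    simp [ψ₀, b.constr_basis, hy]
  | zero => simp
  | add x y _ _ hx hy => rw [map_add, map_add, hx, hy]
  | smul a x _ hx =>
    obtain ⟨a, rfl⟩ := Ideal.Quotient.mk_surjective a
    have h : (Ideal.Quotient.mk (vanishingIdeal V σ.carrier) a) • x = a • x := rfl
    rw [h, map_smul, map_smul, hx]

lemma free_finite {σ : Cone V} {M : Type} [AddCommGroup M] [Module (PolyRing V) M]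
    (hM : FreeOverCone V σ M) (N : Submodule (PolyRing V) M) (hN : N.FG)
    (hNm : N ⊔ mSub V M = ⊤) : Module.Finite (PolyRing V) M := by
  obtain ⟨hT, hfree⟩ := hM
  let _ := hT.module
  have _ : Module.Free (coneRing V σ) M := hfree
  have _ : IsScalarTower (PolyRing V) (coneRing V σ) M := hT.isScalarTower
  let b := Module.Free.chooseBasis (coneRing V σ) M
  obtain ⟨S, hS⟩ := hN
  let I : Finset (Module.Free.ChooseBasisIndex (coneRing V σ) M) :=
    S.biUnion (fun x => (b.repr x).support)
  have hone : (1 : coneRing V σ) ∉ (mId V).map (Ideal.Quotient.mk (vanishingIdeal V σ.carrier)) := by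
    intro h
    rw [Ideal.mem_map_iff_of_surjective _ Ideal.Quotient.mk_surjective] at h
    obtain ⟨a, ha, ha1⟩ := h
    have h1 : Ideal.Quotient.mk (vanishingIdeal V σ.carrier) a = Ideal.Quotient.mk _ 1 := by
      rw [ha1, map_one]
    rw [Ideal.Quotient.eq] at h1
    have h2 := sub_mem ha (van_le σ h1)
    rw [sub_sub_cancel] at h2
    rw [mem_mId] at h2
    simp at h2
  have hall : ∀ j, j ∈ I := by
    intro j
    by_contra hj
    apply hone
    have hmem : ∀ x : M, b.repr x j ∈ (mId V).map (Ideal.Quotient.mk (vanishingIdeal V σ.carrier)) := by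
      intro x
      have hx : x ∈ N ⊔ mSub V M := by rw [hNm]; trivial
      obtain ⟨n, hn, z, hz, rfl⟩ := Submodule.mem_sup.1 hx
      clear hx
      rw [map_add, Finsupp.add_apply]
      refine add_mem ?_ ?_
      · rw [← hS] at hn
        have : b.repr n j = 0 := by
          induction hn using Submodule.span_induction with
          | mem x h =>
            by_contra hne
            exact hj (Finset.mem_biUnion.2 ⟨x, h, Finsupp.mem_support_iff.2 hne⟩)
          | zero => simp
          | add x y _ _ hx hy =>
            rw [map_add, Finsupp.add_apply, hx, hy, add_zero]
          | smul a x _ hx =>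
            have h : a • x = (Ideal.Quotient.mk (vanishingIdeal V σ.carrier) a) • x := rfl
            rw [h, map_smul, Finsupp.smul_apply, hx, smul_zero]
        rw [this]; exact zero_mem _
      · refine Submodule.smul_induction_on hz ?_ ?_
        · intro a ha y _
          have h : a • y = (Ideal.Quotient.mk (vanishingIdeal V σ.carrier) a) • y := rfl
          rw [h, map_smul, Finsupp.smul_apply, smul_eq_mul]
          exact Ideal.mul_mem_right _ _ (Ideal.mem_map_of_mem _ ha)
        · intro x y hx hy
          rw [map_add, Finsupp.add_apply]; exact add_mem hx hy
    simpa using hmem (b j)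
  have _ : Finite (Module.Free.ChooseBasisIndex (coneRing V σ) M) :=
    Fintype.finite ⟨I, hall⟩
  have hf : Module.Finite (coneRing V σ) M := Module.Finite.of_basis b
  exact Module.Finite.trans (coneRing V σ) M

lemma free_ann {σ : Cone V} {M : Type} [AddCommGroup M] [Module (PolyRing V) M] [Nontrivial M]
    (hM : FreeOverCone V σ M) {a : PolyRing V} (ha : ∀ x : M, a • x = 0) :
    a ∈ vanishingIdeal V σ.carrier := by
  obtain ⟨hT, hfree⟩ := hM
  let _ := hT.module
  have _ : Module.Free (coneRing V σ) M := hfree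
  let b := Module.Free.chooseBasis (coneRing V σ) M
  obtain ⟨i⟩ := b.index_nonempty
  have h : (Ideal.Quotient.mk (vanishingIdeal V σ.carrier) a) • b i = 0 := ha (b i)
  have h2 := congrArg (fun z => b.repr z i) h
  simp only [map_smul, Finsupp.smul_apply, b.repr_self, Finsupp.single_eq_same, map_zero,
    Finsupp.coe_zero, Pi.zero_apply, smul_eq_mul, mul_one] at h2
  exact Ideal.Quotient.eq_zero_iff_mem.1 h2

/-! ### Fan combinatorics -/

lemma cone_ext {σ τ : Cone V} (h : σ.carrier = τ.carrier) : σ = τ := by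
  cases σ; cases τ; simp only at h; subst h; rfl

lemma face_subset {σ τ : Cone V} (h : τ.IsFaceOf σ) : τ.carrier ⊆ σ.carrier := by
  obtain ⟨f, _, hf⟩ := h
  rw [hf]; exact Set.inter_subset_left

lemma proper_ssubset {σ τ : Cone V} (h : τ.IsProperFaceOf σ) : τ.carrier ⊂ σ.carrier :=
  (face_subset h.1).ssubset_of_ne fun h' => h.2 (cone_ext h')

lemma face_of_subset (Δ : Fan V) {σ τ : Cone V} (hσ : σ ∈ Δ.cones) (hτ : τ ∈ Δ.cones)
    (h : τ.carrier ⊆ σ.carrier) : τ.IsFaceOf σ := by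
  obtain ⟨υ, _, h1, _, h3⟩ := Δ.inter_mem σ hσ τ hτ
  rw [Set.inter_eq_right.2 h] at h3
  rwa [cone_ext h3] at h1

lemma no_proper_zero {τ : Cone V} (h : τ.IsProperFaceOf (zeroCone V)) : False := by
  have h1 := proper_ssubset h
  apply h1.2
  intro x hx
  have : x = 0 := hx
  rw [this]; exact zero_mem_cone τ

/-- Induction over the cones of a fan, adding one cone at a time. -/
lemma chain {Δ : Fan V} (P : Set Δ.cones → Prop) (h0 : P {Δ.ozero})
    (hs : ∀ Λ : Set Δ.cones, Δ.ozero ∈ Λ →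
      (∀ σ ∈ Λ, ∀ τ : Δ.cones, τ.1.IsFaceOf σ.1 → τ ∈ Λ) → P Λ →
      ∀ σ : Δ.cones, σ ∉ Λ → (∀ τ : Δ.cones, τ.1.IsProperFaceOf σ.1 → τ ∈ Λ) →
      P (insert σ Λ)) : P Set.univ := by
  have _ : Finite Δ.cones := Δ.finite
  have key : ∀ (n : ℕ) (Λ : Set Δ.cones), Λᶜ.ncard = n → Δ.ozero ∈ Λ →
      (∀ σ ∈ Λ, ∀ τ : Δ.cones, τ.1.IsFaceOf σ.1 → τ ∈ Λ) → P Λ → P Set.univ := by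
    intro n
    induction n with
    | zero =>
      intro Λ h _ _ hP
      rw [Set.ncard_eq_zero, Set.compl_empty_iff] at h
      rwa [h] at hP
    | succ n ih =>
      intro Λ h ho hd hP
      have hne : (Λᶜ).Nonempty := by
        rw [Set.nonempty_iff_ne_empty]; rintro h'; rw [h'] at h; simp at h
      obtain ⟨σ, hσ, hmin⟩ := Set.Finite.exists_minimalFor (fun σ : Δ.cones => σ.1.carrier)
        Λᶜ (Set.toFinite _) hne
      have hpr : ∀ τ : Δ.cones, τ.1.IsProperFaceOf σ.1 → τ ∈ Λ := by
        intro τ hτ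
        by_contra hτΛ
        exact (proper_ssubset hτ).2 (hmin hτΛ (proper_ssubset hτ).1)
      refine ih (insert σ Λ) ?_ (Set.mem_insert_of_mem _ ho) ?_ (hs Λ ho hd hP σ hσ hpr)
      · have h2 : (insert σ Λ)ᶜ = Λᶜ \ {σ} := by
          ext x; simp [not_or, and_comm]
        rw [h2, Set.ncard_sdiff_singleton_of_mem hσ, h]; rfl
      · rintro σ' (rfl | hσ') τ hτ
        · by_cases hst : τ = σ'
          · exact Or.inl hst
          · exact Or.inr (hpr τ ⟨hτ, fun h => hst (Subtype.ext h)⟩)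
        · exact Or.inr (hd σ' hσ' τ hτ)
  refine key _ {Δ.ozero} rfl rfl ?_ h0
  rintro σ rfl τ hτ
  by_contra h
  exact no_proper_zero ⟨hτ, fun h' => h (Subtype.ext h')⟩


/-! ### Sections as graded modules -/

/-- The homogeneous component of a section. -/
def secComp {Δ : Fan V} (F : FanSheaf Δ) (Λ : Set (Cone V)) (q : ℤ) : F.Sec Λ →ₗ[ℝ] F.Sec Λ where
  toFun s := ⟨fun σ => comp (F.stalk σ) q (s.1 σ), by
    refine ⟨fun σ hσ => by
      change comp (F.stalk σ) q (s.1 σ) = 0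
      rw [s.2.1 σ hσ, map_zero], fun σ τ hσ hτ h => ?_⟩
    rw [← comp_hom, s.2.2 σ τ hσ hτ h]⟩
  map_add' a b := by
    apply Subtype.ext; funext σ
    exact map_add (comp (F.stalk σ) q) _ _
  map_smul' c a := by
    apply Subtype.ext; funext σ
    exact map_smul (comp (F.stalk σ) q) c _

lemma sec_internal {Δ : Fan V} (F : FanSheaf Δ) (Λ : Set (Cone V)) :
    DirectSum.IsInternal (F.secDeg Λ) := by
  have _ : Finite Δ.cones := Δ.finite
  have _ := Fintype.ofFinite Δ.cones
  apply DirectSum.isInternal_submodule_of_iSupIndep_of_iSup_eq_top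
  · intro q
    rw [Submodule.disjoint_def]
    intro x hx hx'
    have h1 : secComp F Λ q x = x := by
      apply Subtype.ext; funext σ
      exact comp_same _ (hx σ)
    have h2 : (⨆ j, ⨆ (_ : j ≠ q), F.secDeg Λ j) ≤ LinearMap.ker (secComp F Λ q) := by
      refine iSup₂_le fun j hj y hy => ?_
      rw [LinearMap.mem_ker]
      apply Subtype.ext; funext σ
      exact comp_ne _ (hy σ) hj
    rw [← h1]
    exact h2 hx'
  · rw [eq_top_iff]
    intro s _
    choose T hT using fun σ : Δ.cones => comp_sum (F.stalk σ) (s.1 σ)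
    let S : Finset ℤ := Finset.univ.biUnion T
    have hs : s = ∑ q ∈ S, secComp F Λ q s := by
      apply Subtype.ext; funext σ
      rw [AddSubmonoidClass.coe_finsetSum, Finset.sum_apply]
      exact (hT σ S (Finset.subset_biUnion_of_mem T (Finset.mem_univ σ))).symm
    rw [hs]
    refine sum_mem fun q _ => Submodule.mem_iSup_of_mem q ?_
    intro σ
    exact comp_mem _ q _

/-- Sections as a graded module. -/
abbrev secG {Δ : Fan V} (F : FanSheaf Δ) (Λ : Set (Cone V)) : GAMod V where
  M := F.Sec Λ
  deg := F.secDeg Λ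
  internal := sec_internal F Λ
  smul_deg p q a ha _ hx σ := (F.stalk σ).smul_deg p q a ha _ (hx σ)

/-- Restriction to the boundary as a graded homomorphism. -/
def bdG {Δ : Fan V} (F : FanSheaf Δ) (σ : Δ.cones) :
    GHom (F.stalk σ) (secG F (FanSheaf.bdFan σ)) where
  toLin := F.bdRes σ
  deg_mem q x hx τ := by
    change (if h : Cone.IsProperFaceOf τ.1 σ.1 then (F.res σ τ h.1).toLin x else 0) ∈ _
    split_ifs with h
    · exact (F.res σ τ h.1).deg_mem q x hx
    · exact zero_mem _

lemma bdRes_apply {Δ : Fan V} (F : FanSheaf Δ) {σ τ : Δ.cones} (h : Cone.IsProperFaceOf τ.1 σ.1)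
    (x : (F.stalk σ).M) : (F.bdRes σ x).1 τ = (F.res σ τ h.1).toLin x := by
  change (if h : Cone.IsProperFaceOf τ.1 σ.1 then (F.res σ τ h.1).toLin x else 0) = _
  rw [dif_pos h]

lemma sec_induction {Δ : Fan V} (F : FanSheaf Δ) (Λ : Set (Cone V)) {P : F.Sec Λ → Prop} (h0 : P 0)
    (hadd : ∀ x y, P x → P y → P (x + y)) (hh : ∀ q, ∀ x ∈ F.secDeg Λ q, P x)
    (x : F.Sec Λ) : P x :=
  hom_induction (secG F Λ) (P := P) h0 hadd hh x

lemma exists_fg_sup {R M : Type} [CommRing R] [AddCommGroup M] [Module R M] (p : Submodule R M)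
    (h : Module.Finite R (M ⧸ p)) : ∃ N : Submodule R M, N.FG ∧ N ⊔ p = ⊤ := by
  obtain ⟨S, hS⟩ := h.fg_top
  let g := Function.surjInv p.mkQ_surjective
  have hg : ∀ y, p.mkQ (g y) = y := Function.surjInv_eq p.mkQ_surjective
  refine ⟨Submodule.span R (S.image g), ⟨S.image g, rfl⟩, ?_⟩
  have h1 : (Submodule.span R (S.image g : Set M)).map p.mkQ = ⊤ := by
    rw [Submodule.map_span, Finset.coe_image, Set.image_image]
    simp only [hg, Set.image_id']
    exact hS
  have h2 := Submodule.comap_map_mkQ p (Submodule.span R (S.image g : Set M))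
  rw [h1, Submodule.comap_top] at h2
  rw [sup_comm, ← h2]

lemma bd_sup {Δ : Fan V} {F : FanSheaf Δ} (hF : F.IsMES) {σ : Δ.cones}
    (hσ : σ.1 ≠ zeroCone V) (s : F.Sec (FanSheaf.bdFan σ)) :
    ∃ x, s - F.bdRes σ x ∈ mSub V (F.Sec (FanSheaf.bdFan σ)) := by
  refine sec_induction F (FanSheaf.bdFan σ)
    (P := fun s : F.Sec (FanSheaf.bdFan σ) =>
      ∃ x, s - F.bdRes σ x ∈ mSub V (F.Sec (FanSheaf.bdFan σ))) ?_ ?_ ?_ s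
  · exact ⟨0, by simp⟩
  · rintro s t ⟨x, hx⟩ ⟨y, hy⟩
    refine ⟨x + y, ?_⟩
    rw [map_add]
    have := add_mem hx hy
    rwa [sub_add_sub_comm] at this
  · intro q s hs
    have h1 : (mSub V (F.Sec (FanSheaf.bdFan σ))).mkQ s ∈
        mRedPiece V (M := F.Sec (FanSheaf.bdFan σ)) (F.secDeg (FanSheaf.bdFan σ) q) :=
      Submodule.mem_map_of_mem
        (f := (mSub V (F.Sec (FanSheaf.bdFan σ))).mkQ.restrictScalars ℝ) hs
    obtain ⟨y, hy, hys⟩ := (hF.2.2 σ hσ q).surjOn h1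
    obtain ⟨x, hx, rfl⟩ := hy
    refine ⟨x, ?_⟩
    rw [← Submodule.Quotient.mk_eq_zero, Submodule.Quotient.mk_sub, sub_eq_zero]
    exact hys.symm

lemma bd_inj {Δ : Fan V} {F : FanSheaf Δ} (hF : F.IsMES) {σ : Δ.cones}
    (hσ : σ.1 ≠ zeroCone V) (x : (F.stalk σ).M)
    (hx : F.bdRes σ x ∈ mSub V (F.Sec (FanSheaf.bdFan σ))) : x ∈ mSub V (F.stalk σ).M := by
  obtain ⟨T, hT⟩ := comp_sum (F.stalk σ) x
  rw [← hT T le_rfl]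
  refine sum_mem fun q _ => ?_
  have h1 : F.bdRes σ (comp (F.stalk σ) q x) ∈ mSub V (F.Sec (FanSheaf.bdFan σ)) := by
    have h2 := mSub_comp (secG F (FanSheaf.bdFan σ)) q hx
    have h3 := comp_hom (bdG F σ) q x
    change comp (secG F (FanSheaf.bdFan σ)) q (F.bdRes σ x) = F.bdRes σ _ at h3
    rw [← h3]
    exact h2
  have hmem : (mSub V (F.stalk σ).M).mkQ (comp (F.stalk σ) q x) ∈
      mRedPiece V ((F.stalk σ).deg q) :=
    Submodule.mem_map_of_mem
      (f := (mSub V (F.stalk σ).M).mkQ.restrictScalars ℝ) (comp_mem _ q x)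
  have h4 := (hF.2.2 σ hσ q).injOn hmem (zero_mem _) (by
    rw [map_zero]
    exact (Submodule.Quotient.mk_eq_zero _).2 h1)
  exact (Submodule.Quotient.mk_eq_zero _).1 h4

lemma sec_finite [FiniteDimensional ℝ V] {Δ : Fan V} (F : FanSheaf Δ) (Λ : Set (Cone V))
    (h : ∀ τ : Δ.cones, τ.1 ∈ Λ → Module.Finite (PolyRing V) (F.stalk τ).M) :
    Module.Finite (PolyRing V) (F.Sec Λ) := by
  have _ : IsNoetherianRing (PolyRing V) := noeth
  have _ : Finite Δ.cones := Δ.finite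
  have _ : ∀ τ : {τ : Δ.cones // τ.1 ∈ Λ}, Module.Finite (PolyRing V) (F.stalk τ.1).M :=
    fun τ => h τ.1 τ.2
  let f : F.Sec Λ →ₗ[PolyRing V] (∀ τ : {τ : Δ.cones // τ.1 ∈ Λ}, (F.stalk τ.1).M) :=
    { toFun := fun s τ => s.1 τ.1
      map_add' := fun _ _ => rfl
      map_smul' := fun _ _ => rfl }
  refine Module.Finite.of_injective f ?_
  intro s t hst
  apply Subtype.ext; funext σ
  by_cases hσ : σ.1 ∈ Λ
  · exact congrFun hst ⟨σ, hσ⟩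
  · rw [s.2.1 σ hσ, t.2.1 σ hσ]

lemma stalk_finite [FiniteDimensional ℝ V] {Δ : Fan V} {F : FanSheaf Δ} (hF : F.IsMES)
    (σ : Δ.cones) : Module.Finite (PolyRing V) (F.stalk σ).M := by
  have _ : IsNoetherianRing (PolyRing V) := noeth
  refine chain (fun Λ => ∀ σ ∈ Λ, Module.Finite (PolyRing V) (F.stalk σ).M) ?_ ?_ σ trivial
  · rintro σ rfl
    have _ : FiniteDimensional ℝ (F.stalk Δ.ozero).M :=
      FiniteDimensional.of_finrank_eq_succ hF.1.2.1
    exact Module.Finite.of_restrictScalars_finite ℝ _ _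
  · rintro Λ ho hd hP σ hσ hpr σ' (rfl | hσ')
    · have hne : σ'.1 ≠ zeroCone V := by
        intro h
        apply hσ
        have : σ' = Δ.ozero := Subtype.ext h
        rwa [this]
      have hfin : Module.Finite (PolyRing V) (F.Sec (FanSheaf.bdFan σ')) :=
        sec_finite F _ fun τ hτ => hP τ (hpr τ hτ)
      have hred : Module.Finite (PolyRing V) (mRed V (F.stalk σ').M) := by
        refine Module.Finite.of_injective (F.bdResRed σ') ?_
        rw [injective_iff_map_eq_zero]
        intro y hy
        obtain ⟨x, rfl⟩ := Submodule.mkQ_surjective _ y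
        refine (Submodule.Quotient.mk_eq_zero _).2 ?_
        exact bd_inj hF hne x ((Submodule.Quotient.mk_eq_zero _).1 hy)
      obtain ⟨N, hN, hNm⟩ := exists_fg_sup (mSub V (F.stalk σ').M) hred
      exact free_finite (hF.2.1 σ') N hN hNm
    · exact hP σ' hσ'

lemma bd_surj [FiniteDimensional ℝ V] {Δ : Fan V} {F : FanSheaf Δ} (hF : F.IsMES) {σ : Δ.cones}
    (hσ : σ.1 ≠ zeroCone V) : Function.Surjective (F.bdRes σ) := by
  have _ : Module.Finite (PolyRing V) (secG F (FanSheaf.bdFan σ)).M :=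
    sec_finite F _ fun τ _ => stalk_finite hF τ
  have h := graded_nakayama (secG F (FanSheaf.bdFan σ)) (LinearMap.range (bdG F σ).toLin) ?_ ?_
  · exact LinearMap.range_eq_top.1 h
  · rintro _ ⟨x, rfl⟩ q
    rw [comp_hom]
    exact ⟨_, rfl⟩
  · rw [eq_top_iff]
    intro s _
    obtain ⟨x, hx⟩ := bd_sup hF hσ s
    exact Submodule.mem_sup.2 ⟨F.bdRes σ x, ⟨x, rfl⟩, _, hx, add_sub_cancel _ _⟩


/-! ### Existence -/

lemma ghom_ext {M N : GAMod V} {f g : GHom M N} (h : f.toLin = g.toLin) : f = g := by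
  cases f; cases g; simp only at h; subst h; rfl

lemma exists_inv {M N : GAMod V} (f : GHom M N) : ∃ g : GHom N M,
    Function.Bijective f.toLin → (∀ x, g.toLin (f.toLin x) = x) ∧ ∀ y, f.toLin (g.toLin y) = y := by
  by_cases h : Function.Bijective f.toLin
  · let e := LinearEquiv.ofBijective f.toLin h
    have he : ∀ y, f.toLin (e.symm y) = y := fun y => e.apply_symm_apply y
    refine ⟨⟨e.symm.toLinearMap, ?_⟩, fun _ => ⟨fun x => e.symm_apply_apply x, he⟩⟩
    intro q y hy
    have h1 : comp M q (e.symm y) = e.symm y := by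
      apply h.1
      rw [← comp_hom, he, comp_same N hy]
    change e.symm y ∈ _
    rw [← h1]
    exact comp_mem M q _
  · exact ⟨⟨0, fun q x _ => zero_mem _⟩, fun h' => absurd h' h⟩

/-- Commutation of a family of stalk maps with the restrictions on `Λ`. -/
def CommOn {Δ : Fan V} (F G : FanSheaf Δ) (app : ∀ σ : Δ.cones, GHom (F.stalk σ) (G.stalk σ))
    (Λ : Set (Cone V)) : Prop :=
  ∀ (σ τ : Δ.cones), σ.1 ∈ Λ → τ.1 ∈ Λ → ∀ (h : Cone.IsFaceOf τ.1 σ.1) (x : (F.stalk σ).M),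
    (G.res σ τ h).toLin ((app σ).toLin x) = (app τ).toLin ((F.res σ τ h).toLin x)

/-- The map on sections induced by a family of stalk maps. -/
def secMap {Δ : Fan V} {F G : FanSheaf Δ} (app : ∀ σ : Δ.cones, GHom (F.stalk σ) (G.stalk σ))
    {Λ : Set (Cone V)} (hc : CommOn F G app Λ) : F.Sec Λ →ₗ[PolyRing V] G.Sec Λ where
  toFun s := ⟨fun σ => (app σ).toLin (s.1 σ), by
    refine ⟨fun σ hσ => ?_, fun σ τ hσ hτ h => ?_⟩
    · change (app σ).toLin (s.1 σ) = 0
      rw [s.2.1 σ hσ, map_zero]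
    · change (G.res σ τ h).toLin ((app σ).toLin (s.1 σ)) = (app τ).toLin (s.1 τ)
      rw [hc σ τ hσ hτ h, s.2.2 σ τ hσ hτ h]⟩
  map_add' a b := by
    apply Subtype.ext; funext σ
    exact map_add (app σ).toLin _ _
  map_smul' c a := by
    apply Subtype.ext; funext σ
    exact map_smul (app σ).toLin c _

/-- The graded version of `secMap`. -/
def secMapG {Δ : Fan V} {F G : FanSheaf Δ} (app : ∀ σ : Δ.cones, GHom (F.stalk σ) (G.stalk σ))
    {Λ : Set (Cone V)} (hc : CommOn F G app Λ) : GHom (secG F Λ) (secG G Λ) where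
  toLin := secMap app hc
  deg_mem q _ hs σ := (app σ).deg_mem q _ (hs σ)

lemma exists_lift [FiniteDimensional ℝ V] {Δ : Fan V} {F G : FanSheaf Δ} (hF : F.IsMES)
    (hG : G.IsMES) {σ : Δ.cones} (hσ : σ.1 ≠ zeroCone V)
    (app : ∀ σ : Δ.cones, GHom (F.stalk σ) (G.stalk σ))
    (hc : CommOn F G app (FanSheaf.bdFan σ)) (hs : Function.Surjective (secMap app hc)) :
    ∃ χ : GHom (F.stalk σ) (G.stalk σ), Function.Surjective χ.toLin ∧
      ∀ x, G.bdRes σ (χ.toLin x) = secMap app hc (F.bdRes σ x) := by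
  obtain ⟨ψ, hψ⟩ := free_lift (hF.2.1 σ) (hG.2.1 σ).1 (G.bdRes σ) (bd_surj hG hσ)
    (secMap app hc ∘ₗ F.bdRes σ)
  obtain ⟨χ, hχ⟩ := exists_deg_zero ψ (bdG G σ) (GHom.comp (secMapG app hc) (bdG F σ)) hψ
  have hχ' : ∀ x, G.bdRes σ (χ.toLin x) = secMap app hc (F.bdRes σ x) :=
    fun x => LinearMap.congr_fun hχ x
  refine ⟨χ, ?_, hχ'⟩
  have _ := stalk_finite hG σ
  have h := graded_nakayama (G.stalk σ) (LinearMap.range χ.toLin) ?_ ?_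
  · exact LinearMap.range_eq_top.1 h
  · rintro _ ⟨x, rfl⟩ q
    rw [comp_hom]
    exact ⟨_, rfl⟩
  · rw [eq_top_iff]
    intro y _
    obtain ⟨s, hs⟩ := hs (G.bdRes σ y)
    obtain ⟨x, rfl⟩ := bd_surj hF hσ s
    refine Submodule.mem_sup.2 ⟨χ.toLin x, ⟨x, rfl⟩, y - χ.toLin x, ?_, add_sub_cancel _ _⟩
    apply bd_inj hG hσ
    rw [map_sub, hχ', hs, sub_self]
    exact zero_mem _

lemma exists_step [FiniteDimensional ℝ V] {Δ : Fan V} {F G : FanSheaf Δ} (hF : F.IsMES)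
    (hG : G.IsMES) {σ : Δ.cones} (hσ : σ.1 ≠ zeroCone V)
    (app : ∀ σ : Δ.cones, GHom (F.stalk σ) (G.stalk σ))
    (hc : CommOn F G app (FanSheaf.bdFan σ))
    (hb : ∀ τ : Δ.cones, τ.1 ∈ FanSheaf.bdFan σ → Function.Bijective (app τ).toLin) :
    ∃ χ : GHom (F.stalk σ) (G.stalk σ), Function.Bijective χ.toLin ∧
      ∀ x, G.bdRes σ (χ.toLin x) = secMap app hc (F.bdRes σ x) := by
  choose inv hinv using fun τ => exists_inv (app τ)
  have hc' : CommOn G F inv (FanSheaf.bdFan σ) := by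
    intro τ υ hτ hυ h y
    apply (hb υ hυ).1
    rw [← hc τ υ hτ hυ h, (hinv τ (hb τ hτ)).2, (hinv υ (hb υ hυ)).2]
  have hs : Function.Surjective (secMap app hc) := by
    intro t
    refine ⟨secMap inv hc' t, ?_⟩
    apply Subtype.ext; funext τ
    change (app τ).toLin ((inv τ).toLin (t.1 τ)) = t.1 τ
    by_cases hτ : τ.1 ∈ FanSheaf.bdFan σ
    · exact (hinv τ (hb τ hτ)).2 _
    · rw [t.2.1 τ hτ, map_zero, map_zero]
  have hs' : Function.Surjective (secMap inv hc') := by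
    intro t
    refine ⟨secMap app hc t, ?_⟩
    apply Subtype.ext; funext τ
    change (inv τ).toLin ((app τ).toLin (t.1 τ)) = t.1 τ
    by_cases hτ : τ.1 ∈ FanSheaf.bdFan σ
    · exact (hinv τ (hb τ hτ)).1 _
    · rw [t.2.1 τ hτ, map_zero, map_zero]
  obtain ⟨χ, h1, h2⟩ := exists_lift hF hG hσ app hc hs
  obtain ⟨χ', h1', _⟩ := exists_lift hG hF hσ inv hc' hs'
  refine ⟨χ, ⟨?_, h1⟩, h2⟩
  have _ := stalk_finite hF σ
  have h3 : Function.Injective (χ'.toLin ∘ₗ χ.toLin) :=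
    OrzechProperty.injective_of_surjective_endomorphism _ (h1'.comp h1)
  exact Function.Injective.of_comp h3

lemma exists_iso [FiniteDimensional ℝ V] {Δ : Fan V} {F G : FanSheaf Δ} (hF : F.IsMES)
    (hG : G.IsMES) (φ₀ : GHom (F.stalk Δ.ozero) (G.stalk Δ.ozero))
    (hφ₀ : Function.Bijective φ₀.toLin) :
    ∃ Φ : SheafHom F G, Φ.IsIso ∧ Φ.app Δ.ozero = φ₀ := by
  have key := chain (Δ := Δ) (fun Λ => ∃ app : ∀ σ : Δ.cones, GHom (F.stalk σ) (G.stalk σ),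
    (∀ σ ∈ Λ, Function.Bijective (app σ).toLin) ∧ CommOn F G app (Subtype.val '' Λ) ∧
    app Δ.ozero = φ₀) ?_ ?_
  · obtain ⟨app, hb, hc, h0⟩ := key
    refine ⟨⟨app, fun σ τ h => ?_⟩, fun σ => hb σ trivial, h0⟩
    ext x
    exact hc σ τ ⟨σ, trivial, rfl⟩ ⟨τ, trivial, rfl⟩ h x
  · refine ⟨Function.update (fun σ => ⟨0, fun q x _ => zero_mem _⟩) Δ.ozero φ₀, ?_, ?_, ?_⟩
    · rintro σ rfl
      rw [Function.update_self]; exact hφ₀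
    · rintro σ τ hσ hτ h x
      simp only [Set.image_singleton, Set.mem_singleton_iff] at hσ hτ
      obtain rfl : σ = Δ.ozero := Subtype.ext hσ
      obtain rfl : τ = Δ.ozero := Subtype.ext hτ
      rw [F.res_self, G.res_self]; rfl
    · rw [Function.update_self]
  · rintro Λ ho hd ⟨app, hb, hc, h0⟩ σ hσ hpr
    have hne : σ ≠ Δ.ozero := by rintro rfl; exact hσ ho
    have hne' : σ.1 ≠ zeroCone V := fun h => hne (Subtype.ext h)
    have hbd : ∀ τ : Δ.cones, τ.1 ∈ FanSheaf.bdFan σ → τ ∈ Λ := fun τ hτ => hpr τ hτ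
    have hc' : CommOn F G app (FanSheaf.bdFan σ) := by
      intro τ υ hτ hυ h x
      exact hc τ υ ⟨τ, hbd τ hτ, rfl⟩ ⟨υ, hbd υ hυ, rfl⟩ h x
    obtain ⟨χ, h1, h2⟩ := exists_step hF hG hne' app hc' (fun τ hτ => hb τ (hbd τ hτ))
    have hup : ∀ τ ∈ Λ, Function.update app σ χ τ = app τ := by
      intro τ hτ
      apply Function.update_of_ne
      rintro rfl; exact hσ hτ
    have hΛ : ∀ τ : Δ.cones, τ.1 ∈ Subtype.val '' insert σ Λ → τ = σ ∨ τ ∈ Λ := by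
      rintro τ ⟨τ', h, h'⟩
      rw [Subtype.ext h'] at h
      exact h
    refine ⟨Function.update app σ χ, ?_, ?_, ?_⟩
    · rintro τ (rfl | hτ)
      · rw [Function.update_self]; exact h1
      · rw [hup τ hτ]; exact hb τ hτ
    · intro τ υ hτ hυ h x
      by_cases hτυ : υ = τ
      · subst hτυ
        rw [F.res_self, G.res_self]; rfl
      rcases hΛ τ hτ with rfl | hτ
      · have hp : υ.1.IsProperFaceOf τ.1 := ⟨h, fun h' => hτυ (Subtype.ext h')⟩
        rw [hup υ (hpr υ hp), Function.update_self]
        have h3 := congrArg (fun s => s.1 υ) (h2 x)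
        rw [bdRes_apply G hp] at h3
        rw [h3]
        change (app υ).toLin ((F.bdRes τ x).1 υ) = _
        rw [bdRes_apply F hp]
      · have hυ' := hd τ hτ υ h
        rw [hup τ hτ, hup υ hυ']
        exact hc τ υ ⟨τ, hτ, rfl⟩ ⟨υ, hυ', rfl⟩ h x
    · rw [hup _ ho, h0]


/-! ### Uniqueness in the simplicial case -/

lemma coneGen_mono {s t : Finset V} (h : s ⊆ t) : coneGen s ⊆ coneGen t := by
  rintro x ⟨c, hc, rfl⟩
  refine ⟨fun v => if v ∈ s then c v else 0, ?_, ?_⟩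
  · intro v _
    dsimp only
    split_ifs with hv
    · exact hc v hv
    · exact le_rfl
  · rw [← Finset.sum_subset h]
    · refine Finset.sum_congr rfl fun v hv => by simp [hv]
    · intro v _ hv
      simp [hv]

lemma mem_coneGen {s : Finset V} {v : V} (hv : v ∈ s) : v ∈ coneGen s := by
  refine ⟨fun u => if u = v then 1 else 0, fun u _ => ?_, ?_⟩
  · dsimp only
    split_ifs <;> norm_num
  · simp [ite_smul, hv]

lemma exists_dual {s : Finset V} (hs : LinearIndependent ℝ (fun v : s => (v : V))) {w : V}
    (hw : w ∈ s) : ∃ f : V →ₗ[ℝ] ℝ, f w = 1 ∧ ∀ u ∈ s, u ≠ w → f u = 0 := by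
  obtain ⟨g, hg⟩ := LinearMap.exists_extend (Finsupp.lapply (⟨w, hw⟩ : s) ∘ₗ hs.repr)
  have key : ∀ u (hu : u ∈ s), g u = Finsupp.single (⟨u, hu⟩ : s) (1 : ℝ) ⟨w, hw⟩ := by
    intro u hu
    have hmem : u ∈ Submodule.span ℝ (Set.range (fun v : s => (v : V))) :=
      Submodule.subset_span ⟨⟨u, hu⟩, rfl⟩
    have h1 := LinearMap.congr_fun hg ⟨u, hmem⟩
    have h2 := hs.repr_eq_single (⟨u, hu⟩ : s) ⟨u, hmem⟩ rfl
    simp only [LinearMap.comp_apply, Submodule.subtype_apply,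
      Finsupp.lapply_apply] at h1
    rw [h1]
    exact congrArg (fun z => z (⟨w, hw⟩ : s)) h2
  refine ⟨g, ?_, fun u hu huw => ?_⟩
  · rw [key w hw, Finsupp.single_eq_same]
  · rw [key u hu, Finsupp.single_eq_of_ne]
    intro h
    exact huw (congrArg Subtype.val h).symm

lemma poly_comp (a : PolyRing V) (p : V →ₗ[ℝ] V) :
    ∃ b : PolyRing V, ∀ x, (b : V → ℝ) x = (a : V → ℝ) (p x) := by
  obtain ⟨f, hf⟩ := a
  refine Algebra.adjoin_induction (p := fun f _ => ∃ b : PolyRing V, ∀ x, (b : V → ℝ) x = f (p x))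
    ?_ ?_ ?_ ?_ hf
  · intro g hg
    have hg' : IsLinearMap ℝ g := hg
    refine ⟨⟨fun x => g (p x), Algebra.subset_adjoin ?_⟩, fun x => rfl⟩
    exact ⟨fun x y => by rw [map_add, hg'.map_add], fun c x => by rw [map_smul, hg'.map_smul]⟩
  · intro r
    exact ⟨algebraMap ℝ _ r, fun x => rfl⟩
  · rintro g h _ _ ⟨b, hb⟩ ⟨c, hc⟩
    exact ⟨b + c, fun x => by simp [hb, hc]⟩
  · rintro g h _ _ ⟨b, hb⟩ ⟨c, hc⟩
    exact ⟨b * c, fun x => by simp [hb, hc]⟩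

lemma sum_dual {s t : Finset V} (hts : t ⊆ s) {w : V} {f : V →ₗ[ℝ] ℝ} (hf1 : f w = 1)
    (hf0 : ∀ u ∈ s, u ≠ w → f u = 0) (c : V → ℝ) :
    f (∑ v ∈ t, c v • v) = if w ∈ t then c w else 0 := by
  rw [map_sum]
  simp only [map_smul, smul_eq_mul]
  split_ifs with hw
  · rw [Finset.sum_eq_single w]
    · rw [hf1, mul_one]
    · intro u hu huw
      rw [hf0 u (hts hu) huw, mul_zero]
    · intro h; exact absurd hw h
  · refine Finset.sum_eq_zero fun u hu => ?_
    rw [hf0 u (hts hu) (by rintro rfl; exact hw hu), mul_zero]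

/-- A compatible family of polynomial functions on the facets of a simplicial cone extends. -/
lemma extend_poly {s : Finset V} (hs : LinearIndependent ℝ (fun v : s => (v : V)))
    (c : V → PolyRing V)
    (hc : ∀ v ∈ s, ∀ w ∈ s, ∀ x ∈ coneGen (s.erase v), x ∈ coneGen (s.erase w) →
      (c v : V → ℝ) x = (c w : V → ℝ) x) (U : Finset V) (hU : U ⊆ s) :
    ∃ a : PolyRing V, ∀ w ∈ U, ∀ x ∈ coneGen (s.erase w), (a : V → ℝ) x = (c w : V → ℝ) x := by
  induction U using Finset.induction_on with
  | empty => exact ⟨0, by simp⟩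
  | insert w U hwU ih =>
    obtain ⟨a, ha⟩ := ih ((Finset.subset_insert _ _).trans hU)
    have hw : w ∈ s := hU (Finset.mem_insert_self _ _)
    obtain ⟨f, hf1, hf0⟩ := exists_dual hs hw
    let p : V →ₗ[ℝ] V := LinearMap.id - f.smulRight w
    have hp : ∀ x, p x = x - f x • w := fun x => rfl
    have hpx : ∀ t ⊆ s, ∀ x ∈ coneGen t, p x ∈ coneGen (t.erase w) := by
      rintro t ht x ⟨d, hd, rfl⟩
      refine ⟨d, fun v hv => hd v (Finset.mem_of_mem_erase hv), ?_⟩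
      rw [hp, sum_dual ht hf1 hf0]
      split_ifs with hwt
      · rw [← Finset.add_sum_erase t _ hwt, add_sub_cancel_left]
      · rw [Finset.erase_eq_of_notMem hwt, zero_smul, sub_zero]
    obtain ⟨b, hb⟩ := poly_comp (c w - a) p
    refine ⟨a + b, ?_⟩
    intro v hv x hx
    have hadd : ((a + b : PolyRing V) : V → ℝ) x
        = (a : V → ℝ) x + ((c w : V → ℝ) (p x) - (a : V → ℝ) (p x)) := by
      simp [hb]
    rw [hadd]
    rcases Finset.mem_insert.1 hv with rfl | hv
    · have : p x = x := by
        obtain ⟨d, hd, rfl⟩ := hx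
        rw [hp, sum_dual (Finset.erase_subset v s) hf1 hf0]
        simp
      rw [this]; ring
    · have hvs : v ∈ s := hU (Finset.mem_insert_of_mem hv)
      have h1 := hpx _ (Finset.erase_subset v s) x hx
      have h2 : p x ∈ coneGen (s.erase v) := coneGen_mono (Finset.erase_subset _ _) h1
      have h3 : p x ∈ coneGen (s.erase w) :=
        coneGen_mono (Finset.erase_subset_erase _ (Finset.erase_subset _ _)) h1
      rw [ha v hv x hx, ha v hv _ h2, hc v hvs w hw _ h2 h3]; ring

/-- The facets of a simplicial cone. -/
lemma exists_facet {Δ : Fan V} (σ : Δ.cones) {s : Finset V}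
    (hs : LinearIndependent ℝ (fun v : s => (v : V))) (hσ : σ.1.carrier = coneGen s) (w : V) :
    ∃ τ : Δ.cones, w ∈ s → τ.1.IsProperFaceOf σ.1 ∧ τ.1.carrier = coneGen (s.erase w) := by
  by_cases hw : w ∈ s
  swap
  · exact ⟨σ, fun h => absurd h hw⟩
  obtain ⟨f, hf1, hf0⟩ := exists_dual hs hw
  have hsub : coneGen (s.erase w) ⊆ σ.1.carrier := by
    rw [hσ]; exact coneGen_mono (Finset.erase_subset _ _)
  let τ : Cone V := ⟨coneGen (s.erase w), ⟨_, rfl⟩,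
    fun x hx hx' => σ.1.pointed x (hsub hx) (hsub hx')⟩
  have hface : τ.IsFaceOf σ.1 := by
    refine ⟨f, ?_, ?_⟩
    · intro x hx
      rw [hσ] at hx
      obtain ⟨c, hc, rfl⟩ := hx
      rw [sum_dual (Finset.Subset.refl s) hf1 hf0, if_pos hw]
      exact hc w hw
    · apply Set.Subset.antisymm
      · intro x hx
        refine ⟨hsub hx, ?_⟩
        obtain ⟨c, hc, rfl⟩ := hx
        change f _ = 0
        rw [sum_dual (Finset.erase_subset w s) hf1 hf0]
        simp
      · rintro x ⟨hx, hfx⟩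
        rw [hσ] at hx
        obtain ⟨c, hc, rfl⟩ := hx
        change f _ = 0 at hfx
        rw [sum_dual (Finset.Subset.refl s) hf1 hf0, if_pos hw] at hfx
        refine ⟨c, fun v hv => hc v (Finset.mem_of_mem_erase hv), ?_⟩
        rw [← Finset.add_sum_erase s _ hw, hfx, zero_smul, zero_add]
  refine ⟨⟨τ, Δ.face_mem σ.1 σ.2 τ hface⟩, fun _ => ⟨⟨hface, ?_⟩, rfl⟩⟩
  intro h
  have h1 : w ∈ coneGen (s.erase w) := by
    have : w ∈ σ.1.carrier := by rw [hσ]; exact mem_coneGen hw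
    rw [← h] at this
    exact this
  obtain ⟨c, _, hc⟩ := h1
  have h2 := congrArg f hc
  rw [sum_dual (Finset.erase_subset w s) hf1 hf0, hf1] at h2
  simp at h2

lemma face_in_facet {σ τ : Cone V} {s : Finset V} (hσ : σ.carrier = coneGen s)
    (h : τ.IsProperFaceOf σ) : ∃ w ∈ s, τ.carrier ⊆ coneGen (s.erase w) := by
  obtain ⟨⟨f, hf, hτ⟩, hne⟩ := h
  have h1 : ∃ w ∈ s, f w ≠ 0 := by
    by_contra hcon
    push Not at hcon
    apply hne
    apply cone_ext
    rw [hτ]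
    apply Set.inter_eq_left.2
    intro x hx
    rw [hσ] at hx
    obtain ⟨c, hc, rfl⟩ := hx
    change f _ = 0
    rw [map_sum]
    refine Finset.sum_eq_zero fun v hv => ?_
    rw [map_smul, hcon v hv, smul_zero]
  obtain ⟨w, hw, hfw⟩ := h1
  refine ⟨w, hw, ?_⟩
  intro x hx
  rw [hτ] at hx
  obtain ⟨hx, hfx⟩ := hx
  rw [hσ] at hx
  obtain ⟨c, hc, rfl⟩ := hx
  change f _ = 0 at hfx
  rw [map_sum] at hfx
  have h0 := (Finset.sum_eq_zero_iff_of_nonneg (fun v hv => by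
    rw [map_smul, smul_eq_mul]
    refine mul_nonneg (hc v hv) (hf v ?_)
    rw [hσ]; exact mem_coneGen hv)).1 hfx w hw
  rw [map_smul, smul_eq_mul] at h0
  have hcw : c w = 0 := (mul_eq_zero.1 h0).resolve_right hfw
  refine ⟨c, fun v hv => hc v (Finset.mem_of_mem_erase hv), ?_⟩
  rw [← Finset.add_sum_erase s _ hw, hcw, zero_smul, zero_add]

lemma span_homog (M : GAMod V) {e : M.M} (he : e ∈ M.deg 0) :
    ∀ x ∈ Submodule.span (PolyRing V) {e}, ∀ q, comp M q x ∈ Submodule.span (PolyRing V) {e} := by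
  intro x hx q
  obtain ⟨a, rfl⟩ := Submodule.mem_span_singleton.1 hx
  clear hx
  induction a using poly_induction with
  | h0 => simp
  | hadd a b ha hb => rw [add_smul, map_add]; exact add_mem ha hb
  | hh k a ha =>
    have := comp_smul M (AdegN_le k ha) (q - 2 * k) e
    rw [add_sub_cancel] at this
    rw [this]
    refine Submodule.smul_mem _ _ ?_
    by_cases h : 0 = q - 2 * k
    · rw [← h, comp_same M he]
      exact Submodule.mem_span_singleton_self e
    · rw [comp_ne M he h]
      exact zero_mem _

lemma sec_cyclic {Δ : Fan V} {F : FanSheaf Δ} (hF : F.IsMES)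
    (σ : Δ.cones) (hσ : σ.1.IsSimplicial) (e : ∀ τ : Δ.cones, (F.stalk τ).M)
    (hsp : ∀ τ : Δ.cones, τ.1.IsProperFaceOf σ.1 → Submodule.span (PolyRing V) {e τ} = ⊤)
    (hne : ∀ τ : Δ.cones, τ.1.IsProperFaceOf σ.1 → e τ ≠ 0)
    (hcomp : ∀ τ υ : Δ.cones, τ.1.IsProperFaceOf σ.1 → υ.1.IsProperFaceOf σ.1 →
      ∀ h : υ.1.IsFaceOf τ.1, (F.res τ υ h).toLin (e τ) = e υ)
    (t : F.Sec (FanSheaf.bdFan σ)) :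
    ∃ a : PolyRing V, ∀ τ : Δ.cones, τ.1.IsProperFaceOf σ.1 → t.1 τ = a • e τ := by
  obtain ⟨s, hs, hσs⟩ := hσ
  have h1 : ∀ τ : Δ.cones, ∃ a : PolyRing V, τ.1.IsProperFaceOf σ.1 → t.1 τ = a • e τ := by
    intro τ
    by_cases h : τ.1.IsProperFaceOf σ.1
    · have h2 : t.1 τ ∈ Submodule.span (PolyRing V) {e τ} := by rw [hsp τ h]; trivial
      obtain ⟨a, ha⟩ := Submodule.mem_span_singleton.1 h2
      exact ⟨a, fun _ => ha.symm⟩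
    · exact ⟨0, fun h' => absurd h' h⟩
  choose a ha using h1
  have star : ∀ τ υ : Δ.cones, τ.1.IsProperFaceOf σ.1 → υ.1.IsProperFaceOf σ.1 →
      υ.1.IsFaceOf τ.1 → ∀ x ∈ υ.1.carrier, (a τ : V → ℝ) x = (a υ : V → ℝ) x := by
    intro τ υ hτ hυ h x hx
    have h3 := t.2.2 τ υ hτ hυ h
    rw [ha τ hτ, ha υ hυ, map_smul, hcomp τ υ hτ hυ h, ← sub_eq_zero, ← sub_smul] at h3
    have _ : Nontrivial (F.stalk υ).M := ⟨_, _, hne υ hυ⟩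
    have h4 : a τ - a υ ∈ vanishingIdeal V υ.1.carrier := by
      refine free_ann (hF.2.1 υ) fun y => ?_
      have hy : y ∈ Submodule.span (PolyRing V) {e υ} := by rw [hsp υ hυ]; trivial
      obtain ⟨b, rfl⟩ := Submodule.mem_span_singleton.1 hy
      rw [smul_comm, h3, smul_zero]
    have h5 := mem_van.1 h4 x hx
    simpa [sub_eq_zero] using h5
  choose φ hφ using exists_facet σ hs hσs
  obtain ⟨b, hb⟩ := extend_poly hs (fun w => a (φ w)) (by
    intro v hv w hw x hxv hxw
    obtain ⟨hpv, hcv⟩ := hφ v hv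
    obtain ⟨hpw, hcw⟩ := hφ w hw
    obtain ⟨υ, hυ, hυv, hυw, hυc⟩ := Δ.inter_mem _ (φ v).2 _ (φ w).2
    have hxυ : x ∈ υ.carrier := by
      rw [hυc, hcv, hcw]; exact ⟨hxv, hxw⟩
    have hpυ : υ.IsProperFaceOf σ.1 := by
      have hss := proper_ssubset hpv
      have hle : υ.carrier ⊆ (φ v).1.carrier := face_subset hυv
      refine ⟨face_of_subset Δ σ.2 hυ (hle.trans hss.1), ?_⟩
      rintro rfl
      exact hss.2 hle
    have e1 := star (φ v) ⟨υ, hυ⟩ hpv hpυ hυv x hxυ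
    have e2 := star (φ w) ⟨υ, hυ⟩ hpw hpυ hυw x hxυ
    exact e1.trans e2.symm) s (Finset.Subset.refl s)
  refine ⟨b, fun τ hτ => ?_⟩
  obtain ⟨w, hw, hτw⟩ := face_in_facet hσs hτ
  obtain ⟨hpw, hcw⟩ := hφ w hw
  have hface : τ.1.IsFaceOf (φ w).1 := face_of_subset Δ (φ w).2 τ.2 (by rw [hcw]; exact hτw)
  have h6 : b - a τ ∈ vanishingIdeal V τ.1.carrier := by
    rw [mem_van]
    intro x hx
    have e1 := hb w hw x (hτw hx)
    have e2 := star (φ w) τ hpw hτ hface x hx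
    have : ((b - a τ : PolyRing V) : V → ℝ) x = (b : V → ℝ) x - (a τ : V → ℝ) x := rfl
    rw [this, e1, e2, sub_self]
  have h7 : (b - a τ) • e τ = 0 := (hF.2.1 τ).1 (x := e τ) (a := ⟨b - a τ, h6⟩)
  rw [sub_smul, sub_eq_zero] at h7
  rw [h7, ha τ hτ]

/-- On a simplicial fan every stalk of a minimal extension sheaf is generated in degree zero. -/
lemma exists_gens [FiniteDimensional ℝ V] {Δ : Fan V} {F : FanSheaf Δ} (hF : F.IsMES)
    (hΔ : Δ.IsSimplicial) : ∃ e : ∀ σ : Δ.cones, (F.stalk σ).M,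
      ∀ σ, e σ ∈ (F.stalk σ).deg 0 ∧ Submodule.span (PolyRing V) {e σ} = ⊤ := by
  have key := chain (Δ := Δ) (fun Λ => ∃ e : ∀ σ : Δ.cones, (F.stalk σ).M,
    (∀ σ ∈ Λ, e σ ∈ (F.stalk σ).deg 0 ∧ Submodule.span (PolyRing V) {e σ} = ⊤ ∧ e σ ≠ 0) ∧
    ∀ σ ∈ Λ, ∀ τ ∈ Λ, ∀ h : Cone.IsFaceOf τ.1 σ.1, (F.res σ τ h).toLin (e σ) = e τ) ?_ ?_
  · obtain ⟨e, he, _⟩ := key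
    exact ⟨e, fun σ => ⟨(he σ trivial).1, (he σ trivial).2.1⟩⟩
  · obtain ⟨x, hx, hspan⟩ := finrank_eq_one_iff'.1 hF.1.2.1
    refine ⟨Function.update (fun σ => 0) Δ.ozero x, ?_, ?_⟩
    · rintro σ rfl
      rw [Function.update_self]
      refine ⟨?_, ?_, hx⟩
      · obtain ⟨T, hT⟩ := comp_sum (F.stalk Δ.ozero) x
        rw [← hT T le_rfl]
        refine sum_mem fun q _ => ?_
        by_cases hq : q = 0
        · subst hq; exact comp_mem _ _ _
        · have h := comp_mem (F.stalk Δ.ozero) q x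
          rw [hF.1.2.2 q hq, Submodule.mem_bot] at h
          rw [h]; exact zero_mem _
      · rw [eq_top_iff]
        intro y _
        obtain ⟨c, rfl⟩ := hspan y
        rw [Submodule.mem_span_singleton]
        exact ⟨algebraMap ℝ (PolyRing V) c, algebraMap_smul _ _ _⟩
    · rintro σ rfl τ rfl h
      rw [F.res_self]; rfl
  · rintro Λ ho hd ⟨e, he, hc⟩ σ hσ hpr
    have hne : σ ≠ Δ.ozero := by rintro rfl; exact hσ ho
    have hne' : σ.1 ≠ zeroCone V := fun h => hne (Subtype.ext h)
    let eb : F.Sec (FanSheaf.bdFan σ) :=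
      ⟨fun τ => if τ.1 ∈ FanSheaf.bdFan σ then e τ else 0, by
        refine ⟨fun τ hτ => if_neg hτ, fun τ υ hτ hυ h => ?_⟩
        beta_reduce
        rw [if_pos hτ, if_pos hυ]
        exact hc τ (hpr τ hτ) υ (hpr υ hυ) h⟩
    have heb : ∀ τ : Δ.cones, τ.1.IsProperFaceOf σ.1 → eb.1 τ = e τ := fun τ hτ => if_pos hτ
    have heb0 : eb ∈ (secG F (FanSheaf.bdFan σ)).deg 0 := by
      intro τ
      by_cases hτ : τ.1.IsProperFaceOf σ.1
      · rw [heb τ hτ]; exact (he τ (hpr τ hτ)).1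
      · rw [eb.2.1 τ hτ]; exact zero_mem _
    obtain ⟨x₀, hx₀⟩ := bd_surj hF hne' eb
    obtain ⟨x, hxdeg, hx⟩ : ∃ x ∈ (F.stalk σ).deg 0, F.bdRes σ x = eb := by
      refine ⟨comp (F.stalk σ) 0 x₀, comp_mem _ _ _, ?_⟩
      have h3 := comp_hom (bdG F σ) 0 x₀
      refine h3.symm.trans ?_
      change comp (secG F (FanSheaf.bdFan σ)) 0 (F.bdRes σ x₀) = eb
      rw [hx₀]
      exact comp_same _ heb0
    have hres : ∀ (τ : Δ.cones) (hτ : τ.1.IsProperFaceOf σ.1), (F.res σ τ hτ.1).toLin x = e τ := by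
      intro τ hτ
      rw [← bdRes_apply F hτ, hx, heb τ hτ]
    have hop : (Δ.ozero).1.IsProperFaceOf σ.1 := by
      refine ⟨face_of_subset Δ σ.2 Δ.ozero.2 ?_, fun h => hne' h.symm⟩
      intro y hy
      have : y = 0 := hy
      rw [this]; exact zero_mem_cone _
    have hx0 : x ≠ 0 := by
      intro h
      have h1 := hres Δ.ozero hop
      rw [h, map_zero] at h1
      exact (he Δ.ozero ho).2.2 h1.symm
    have hspan : Submodule.span (PolyRing V) {x} = ⊤ := by
      have _ := stalk_finite hF σ
      refine graded_nakayama (F.stalk σ) _ (span_homog _ hxdeg) ?_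
      rw [eq_top_iff]
      intro y _
      obtain ⟨a, ha⟩ := sec_cyclic hF σ (hΔ σ.1 σ.2) e (fun τ hτ => (he τ (hpr τ hτ)).2.1)
        (fun τ hτ => (he τ (hpr τ hτ)).2.2)
        (fun τ υ hτ hυ h => hc τ (hpr τ hτ) υ (hpr υ hυ) h) (F.bdRes σ y)
      refine Submodule.mem_sup.2 ⟨a • x, Submodule.smul_mem _ _
        (Submodule.mem_span_singleton_self x), y - a • x, ?_, add_sub_cancel _ _⟩
      apply bd_inj hF hne'
      have : F.bdRes σ y = a • eb := by
        apply Subtype.ext; funext τ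
        change (F.bdRes σ y).1 τ = a • eb.1 τ
        by_cases hτ : τ.1.IsProperFaceOf σ.1
        · rw [ha τ hτ, heb τ hτ]
        · rw [eb.2.1 τ hτ, (F.bdRes σ y).2.1 τ hτ, smul_zero]
      rw [map_sub, map_smul, hx, this, sub_self]
      exact zero_mem _
    have hup : ∀ τ ∈ Λ, Function.update e σ x τ = e τ := by
      intro τ hτ
      apply Function.update_of_ne
      rintro rfl; exact hσ hτ
    refine ⟨Function.update e σ x, ?_, ?_⟩
    · rintro τ (rfl | hτ)
      · rw [Function.update_self]; exact ⟨hxdeg, hspan, hx0⟩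
      · rw [hup τ hτ]; exact he τ hτ
    · intro τ hτ υ hυ h
      by_cases hτυ : υ = τ
      · subst hτυ
        rw [F.res_self]; rfl
      rcases hτ with rfl | hτ
      · have hp : υ.1.IsProperFaceOf τ.1 := ⟨h, fun h' => hτυ (Subtype.ext h')⟩
        rw [hup υ (hpr υ hp), Function.update_self]
        exact hres υ hp
      · have hυ' := hd τ hτ υ h
        rw [hup τ hτ, hup υ hυ']
        exact hc τ hτ υ hυ' h

lemma unique_hom [FiniteDimensional ℝ V] {Δ : Fan V} {F G : FanSheaf Δ} (hF : F.IsMES)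
    (hG : G.IsMES) (hΔ : Δ.IsSimplicial) (Φ Ψ : SheafHom F G)
    (h0 : Ψ.app Δ.ozero = Φ.app Δ.ozero) : Ψ = Φ := by
  obtain ⟨e, he⟩ := exists_gens hF hΔ
  obtain ⟨e', he'⟩ := exists_gens hG hΔ
  have key := chain (Δ := Δ) (fun Λ => ∀ σ ∈ Λ, (Ψ.app σ).toLin = (Φ.app σ).toLin) ?_ ?_
  · have h1 : Ψ.app = Φ.app := by
      funext σ
      exact ghom_ext (key σ trivial)
    cases Ψ; cases Φ; simp only at h1; subst h1; rfl
  · rintro σ rfl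
    rw [h0]
  · rintro Λ ho hd hP σ hσ hpr σ' (rfl | hσ')
    swap
    · exact hP σ' hσ'
    have hne : σ' ≠ Δ.ozero := by rintro rfl; exact hσ ho
    have hne' : σ'.1 ≠ zeroCone V := fun h => hne (Subtype.ext h)
    set y := (Ψ.app σ').toLin (e σ') - (Φ.app σ').toLin (e σ') with hy
    have hydeg : y ∈ (G.stalk σ').deg 0 :=
      sub_mem ((Ψ.app σ').deg_mem 0 _ (he σ').1) ((Φ.app σ').deg_mem 0 _ (he σ').1)
    have hyb : G.bdRes σ' y = 0 := by
      apply Subtype.ext; funext τ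
      change (G.bdRes σ' y).1 τ = 0
      by_cases hτ : τ.1.IsProperFaceOf σ'.1
      · rw [bdRes_apply G hτ, hy, map_sub, ← LinearMap.comp_apply, ← LinearMap.comp_apply,
          Ψ.comm σ' τ hτ.1, Φ.comm σ' τ hτ.1, hP τ (hpr τ hτ), sub_self]
      · exact (G.bdRes σ' y).2.1 τ hτ
    have hym : y ∈ mSub V (G.stalk σ').M := by
      apply bd_inj hG hne'
      rw [hyb]; exact zero_mem _
    rw [mSub, ← (he' σ').2, Submodule.mem_smul_span_singleton] at hym
    obtain ⟨a, ha, hay⟩ := hym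
    have hy0 : y = 0 := by
      rw [← comp_same _ hydeg, ← hay]
      exact comp_m_smul _ (he' σ').1 ha
    ext x
    have hx : x ∈ Submodule.span (PolyRing V) {e σ'} := by rw [(he σ').2]; trivial
    obtain ⟨b, rfl⟩ := Submodule.mem_span_singleton.1 hx
    rw [map_smul, map_smul, sub_eq_zero.1 (hy.symm.trans hy0)]


end MesProof

end MesProof

/-- Any two minimal extension sheaves on a fan `Δ` are isomorphic: every isomorphism
`E•_o ≅ ℝ• ≅ F•_o` of the stalks at the zero cone extends to an isomorphism
`E• ≅ F•` of sheaves of graded `A•`-modules, and in the case of a simplicial fan this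
extension is unique. -/
theorem mes_unique_up_to_iso
    {V : Type} [AddCommGroup V] [Module ℝ V] [FiniteDimensional ℝ V]
    {Δ : Fan V} (F G : FanSheaf Δ) (hF : F.IsMES) (hG : G.IsMES)
    (φ₀ : GHom (F.stalk Δ.ozero) (G.stalk Δ.ozero))
    (hφ₀ : Function.Bijective φ₀.toLin) :
    ∃ Φ : SheafHom F G, Φ.IsIso ∧ Φ.app Δ.ozero = φ₀ ∧
      (Δ.IsSimplicial → ∀ Ψ : SheafHom F G, Ψ.IsIso → Ψ.app Δ.ozero = φ₀ → Ψ = Φ) := by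
  obtain ⟨Φ, hΦ, h0⟩ := MesProof.exists_iso hF hG φ₀ hφ₀
  exact ⟨Φ, hΦ, h0, fun hΔ Ψ _ hΨ => MesProof.unique_hom hF hG hΔ Φ Ψ (hΨ.trans h0.symm)⟩

end
end
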